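/- arXiv:1305.5746 — 3 statements merged into one kernel-verified Lean document; each statement's English description precedes it below -/
import Mathlib

section
/- Let ρ < −1. There exists a weak solution with interacting condensate g ∈ C([0,∞) : M₊([0,∞) : (1+ω)^ρ)) of the isotropic weak turbulence equation with σ = 0, with finite total mass m > 0, such that: (a) g(t,{0}) = 0 for all t ≥ 0; (b) the pulsating alternative holds, i.e. there exists an unbounded set A ⊂ [0,∞) of Lebesgue density one and functions Ω, η : A → (0,∞) with η(t) → 0, Ω(t) → 0 along A and ∫_{(Ω(t)(1−η(t)), Ω(t)(1+η(t)))} g(t,dω) ≥ m(1−η(t)) for t ∈ A; and (c) there exists a constant c₁ > 0, independent of g, such that limsup_{t→∞} inf_{a>0} d*( g(t)_a , m δ₁ ) ≥ c₁, where g(t)_a denotes the pushforward of g(t,·) under the map ω ↦ aω, and d* is a fixed metric metrizing the weak-* topology on finite nonnegative measures on [0,∞) (for instance the Lévy–Prokhorov metric). -/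
open MeasureTheory Real Set Filter Pointwise

noncomputable section

/-- The minimum of the four square roots appearing in the collision kernel. -/
def Phi4 (σ a b c d : ℝ) : ℝ :=
  min (min (Real.sqrt (max (a - σ) 0)) (Real.sqrt (max (b - σ) 0)))
      (min (Real.sqrt (max (c - σ) 0)) (Real.sqrt (max (d - σ) 0)))

/-- The collision kernel `Φ_σ(ω₁,ω₂,ω₃)` with `ω₄ = ω₁+ω₂-ω₃`. -/
def PhiKer (σ ω₁ ω₂ ω₃ : ℝ) : ℝ :=
  if 0 ≤ ω₁ + ω₂ - ω₃ then Phi4 σ ω₁ ω₂ ω₃ (ω₁ + ω₂ - ω₃) else 0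

/-- Membership in `M₊([0,∞) : (1+ω)^ρ)`: a nonnegative measure supported on `[0,∞)`
with `sup_{R>0} (1+R)^{-ρ} R⁻¹ μ([R/2,R]) < ∞`. -/
def MemMplus (ρ : ℝ) (μ : Measure ℝ) : Prop :=
  μ (Set.Iio 0) = 0 ∧
  ∃ C : ℝ, ∀ R : ℝ, 0 < R →
    μ (Set.Icc (R / 2) R) ≤ ENNReal.ofReal (C * (1 + R) ^ ρ * R)

/-- Weak-* continuity in time on `[0,∞)`. -/
def WeakCont (g : ℝ → Measure ℝ) : Prop :=
  ∀ φ : ℝ → ℝ, Continuous φ → HasCompactSupport φ →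
    ContinuousOn (fun t => ∫ ω, φ ω ∂(g t)) (Set.Ici 0)

/-- The cubic collision term tested against `ψ`. -/
def collisionInt (σ : ℝ) (μ : Measure ℝ) (ψ : ℝ → ℝ) : ℝ :=
  ∫ ω₁, (∫ ω₂, (∫ ω₃,
    (PhiKer σ ω₁ ω₂ ω₃ / Real.sqrt (ω₁ * ω₂ * ω₃)) *
      (ψ (ω₁ + ω₂ - ω₃) + ψ ω₃ - ψ ω₁ - ψ ω₂) ∂μ) ∂μ) ∂μ

/-- Test functions: `C²` with compact support. -/
def IsTestFun (φ : ℝ → ℝ → ℝ) : Prop :=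
  ContDiff ℝ 2 (Function.uncurry φ) ∧ HasCompactSupport (Function.uncurry φ)

/-- Weak solution with interacting condensate of the isotropic weak turbulence
equation, with kernel `Φ_σ`, on the time interval `[0,∞)`. -/
def IsWeakSolution (ρ σ : ℝ) (g0 : Measure ℝ) (g : ℝ → Measure ℝ) : Prop :=
  (∀ t : ℝ, 0 ≤ t → MemMplus ρ (g t)) ∧ WeakCont g ∧ g 0 = g0 ∧
  ∀ φ : ℝ → ℝ → ℝ, IsTestFun φ → ∀ tstar : ℝ, 0 ≤ tstar →
    ((∫ ω, φ tstar ω ∂(g tstar)) - ∫ ω, φ 0 ω ∂g0)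
      = (∫ t in Set.Ioc (0:ℝ) tstar, (∫ ω, deriv (fun s => φ s ω) t ∂(g t)))
        + ∫ t in Set.Ioc (0:ℝ) tstar, collisionInt σ (g t) (φ t)

/-- The pulsating property for a solution of mass `m`. -/
def Pulsating (m : ℝ) (g : ℝ → Measure ℝ) : Prop :=
  ∃ A : Set ℝ, (∀ M : ℝ, ∃ t ∈ A, M < t) ∧
    Tendsto (fun T : ℝ => (volume (A ∩ Set.Icc 0 T)).toReal / T) atTop (nhds 1) ∧
    ∃ Om eta : ℝ → ℝ,
      (∀ t ∈ A, 0 < Om t ∧ 0 < eta t) ∧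
      Tendsto eta (atTop ⊓ Filter.principal A) (nhds 0) ∧
      Tendsto Om (atTop ⊓ Filter.principal A) (nhds 0) ∧
      (∀ t ∈ A, ENNReal.ofReal (m * (1 - eta t)) ≤
        g t (Set.Ioo (Om t * (1 - eta t)) (Om t * (1 + eta t))))

namespace WeakTurbulence

open scoped Topology ENNReal NNReal

/-! ### Cubic operators on `ℓ¹` -/

/-- Real sequences indexed by `ℚ` that are absolutely summable. -/
abbrev L1 : Type := lp (fun _ : ℚ => ℝ) 1

lemma summable_abs (x : L1) : Summable fun q => |x q| := by
  simpa using (lp.memℓp x).summable (by simp)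

lemma hasSum_abs (x : L1) : HasSum (fun q => |x q|) ‖x‖ := by
  have h := lp.hasSum_norm (p := 1) (by simp) x
  simpa using h

lemma summable_mul_of_bounded (x : L1) {c : ℚ → ℝ} {C : ℝ} (hc : ∀ q, |c q| ≤ C) :
    Summable fun q => x q * c q := by
  refine Summable.of_norm_bounded ((summable_abs x).mul_right C) fun q => ?_
  rw [norm_mul, Real.norm_eq_abs, Real.norm_eq_abs]
  gcongr
  exact hc q

lemma hasSum_mul_three {a b c : ℚ → ℝ} {A B C : ℝ} (ha : HasSum a A) (hb : HasSum b B)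
    (hc : HasSum c C) :
    HasSum (fun p : ℚ × ℚ × ℚ => a p.1 * b p.2.1 * c p.2.2) (A * B * C) := by
  have h1 : Summable fun p : ℚ × ℚ => b p.1 * c p.2 :=
    summable_mul_of_summable_norm hb.summable.norm hc.summable.norm
  have h2 : HasSum (fun p : ℚ × ℚ => b p.1 * c p.2) (B * C) := hb.mul hc h1
  have h3 : Summable fun p : ℚ × ℚ × ℚ => a p.1 * (b p.2.1 * c p.2.2) :=
    summable_mul_of_summable_norm (g := fun p : ℚ × ℚ => b p.1 * c p.2)
      ha.summable.norm h1.norm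
  have h4 := ha.mul h2 h3
  simpa [mul_assoc] using h4

variable {Y : Type*} [NormedAddCommGroup Y] [NormedSpace ℝ Y]

/-- The cubic operator `x ↦ ∑ x(q₁) x(q₂) x(q₃) V(q₁,q₂,q₃)`. -/
def cubic (V : ℚ × ℚ × ℚ → Y) (x : L1) : Y :=
  ∑' p : ℚ × ℚ × ℚ, (x p.1 * x p.2.1 * x p.2.2) • V p

lemma summable_cubic_norm {V : ℚ × ℚ × ℚ → Y} {C : ℝ} (hV : ∀ p, ‖V p‖ ≤ C) (x : L1) :
    Summable fun p : ℚ × ℚ × ℚ => ‖(x p.1 * x p.2.1 * x p.2.2) • V p‖ := by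
  refine Summable.of_nonneg_of_le (fun _ => norm_nonneg _) (fun p => ?_)
    ((hasSum_mul_three (hasSum_abs x) (hasSum_abs x) (hasSum_abs x)).summable.mul_right C)
  rw [norm_smul, norm_mul, norm_mul]
  simp only [Real.norm_eq_abs]
  gcongr
  exact hV p

lemma summable_cubic [CompleteSpace Y] {V : ℚ × ℚ × ℚ → Y} {C : ℝ} (hV : ∀ p, ‖V p‖ ≤ C) (x : L1) :
    Summable fun p : ℚ × ℚ × ℚ => (x p.1 * x p.2.1 * x p.2.2) • V p :=
  (summable_cubic_norm hV x).of_norm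

lemma norm_cubic_le {V : ℚ × ℚ × ℚ → Y} {C : ℝ} (hV : ∀ p, ‖V p‖ ≤ C) (x : L1) :
    ‖cubic V x‖ ≤ C * ‖x‖ ^ 3 := by
  have h := (hasSum_mul_three (hasSum_abs x) (hasSum_abs x) (hasSum_abs x)).mul_right C
  refine (tsum_of_norm_bounded h fun p => ?_).trans (le_of_eq (by ring))
  rw [norm_smul, norm_mul, norm_mul]
  simp only [Real.norm_eq_abs]
  gcongr
  exact hV p

lemma norm_cubic_sub_le [CompleteSpace Y] {V : ℚ × ℚ × ℚ → Y} {C R : ℝ} (hC : 0 ≤ C) (hV : ∀ p, ‖V p‖ ≤ C)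
    {x y : L1} (hx : ‖x‖ ≤ R) (hy : ‖y‖ ≤ R) :
    ‖cubic V x - cubic V y‖ ≤ 3 * C * R ^ 2 * ‖x - y‖ := by
  have hR : 0 ≤ R := (norm_nonneg x).trans hx
  unfold cubic
  rw [← (summable_cubic hV x).tsum_sub (summable_cubic hV y)]
  have hd := hasSum_abs (x - y)
  have h := (((hasSum_mul_three hd (hasSum_abs x) (hasSum_abs x)).add
    (hasSum_mul_three (hasSum_abs y) hd (hasSum_abs x))).add
    (hasSum_mul_three (hasSum_abs y) (hasSum_abs y) hd)).mul_right C
  refine (tsum_of_norm_bounded h fun p => ?_).trans ?_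
  · rw [← sub_smul, norm_smul, Real.norm_eq_abs]
    refine mul_le_mul ?_ (hV p) (norm_nonneg _) (by positivity)
    have e : x p.1 * x p.2.1 * x p.2.2 - y p.1 * y p.2.1 * y p.2.2
        = (x - y) p.1 * x p.2.1 * x p.2.2 + y p.1 * (x - y) p.2.1 * x p.2.2
          + y p.1 * y p.2.1 * (x - y) p.2.2 := by
      simp only [lp.coeFn_sub, Pi.sub_apply]; ring
    rw [e]
    refine (abs_add_le _ _).trans (add_le_add ((abs_add_le _ _).trans (add_le_add ?_ ?_)) ?_) <;>
      rw [abs_mul, abs_mul]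
  · have h1 : ‖x - y‖ * ‖x‖ * ‖x‖ ≤ ‖x - y‖ * R * R := by gcongr
    have h2 : ‖y‖ * ‖x - y‖ * ‖x‖ ≤ R * ‖x - y‖ * R := by gcongr
    have h3 : ‖y‖ * ‖y‖ * ‖x - y‖ ≤ R * R * ‖x - y‖ := by gcongr
    nlinarith [mul_le_mul_of_nonneg_right (add_le_add (add_le_add h1 h2) h3) hC]

lemma map_cubic [CompleteSpace Y] {V : ℚ × ℚ × ℚ → Y} {C : ℝ} (hV : ∀ p, ‖V p‖ ≤ C) (l : Y →L[ℝ] ℝ) (x : L1) :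
    l (cubic V x) = cubic (fun p => l (V p)) x := by
  unfold cubic
  rw [l.map_tsum (summable_cubic hV x)]
  simp

lemma cubic_smul_arg (V : ℚ × ℚ × ℚ → Y) (s : ℝ) (x : L1) :
    cubic V (s • x) = s ^ 3 • cubic V x := by
  unfold cubic
  rw [← tsum_const_smul'']
  congr 1 with p
  simp only [lp.coeFn_smul, Pi.smul_apply, smul_eq_mul, smul_smul]
  congr 1; ring

/-- Cyclic permutation of a triple. -/
def cyc : (ℚ × ℚ × ℚ) ≃ (ℚ × ℚ × ℚ) where
  toFun p := (p.2.1, p.2.2, p.1)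
  invFun p := (p.2.2, p.1, p.2.1)
  left_inv _ := rfl
  right_inv _ := rfl

lemma cubic_cyc (V : ℚ × ℚ × ℚ → Y) (x : L1) : cubic (fun p => V (cyc p)) x = cubic V x := by
  unfold cubic
  rw [← Equiv.tsum_eq cyc fun p : ℚ × ℚ × ℚ => (x p.1 * x p.2.1 * x p.2.2) • V p]
  congr 1 with p
  simp only [cyc, Equiv.coe_fn_mk]
  congr 1; ring

/-- The sum of a kernel over the three cyclic permutations of its arguments. -/
def cycSum (v : ℚ × ℚ × ℚ → ℝ) (p : ℚ × ℚ × ℚ) : ℝ := v p + v (cyc p) + v (cyc (cyc p))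

lemma cubic_eq_third_cycSum {v : ℚ × ℚ × ℚ → ℝ} {C : ℝ} (hv : ∀ p, ‖v p‖ ≤ C) (x : L1) :
    cubic (cycSum v) x = 3 * cubic v x := by
  have h1 := cubic_cyc v x
  have h2 := cubic_cyc (fun p => v (cyc p)) x
  have s0 := summable_cubic hv x
  have s1 := summable_cubic (V := fun p => v (cyc p)) (fun p => hv _) x
  have s2 := summable_cubic (V := fun p => v (cyc (cyc p))) (fun p => hv _) x
  have : cubic (cycSum v) x = cubic v x + cubic (fun p => v (cyc p)) x
      + cubic (fun p => v (cyc (cyc p))) x := by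
    unfold cubic
    rw [← s0.tsum_add s1, ← (s0.add s1).tsum_add s2]
    congr 1 with p
    simp only [cycSum, smul_eq_mul]; ring
  rw [this, h2, h1]; ring

/-- Symmetrized lower bound: if the cyclic sum is nonnegative then each single term bounds the
cubic form from below. -/
lemma term_le_cubic {v : ℚ × ℚ × ℚ → ℝ} {C : ℝ} (hv : ∀ p, ‖v p‖ ≤ C) {x : L1}
    (hx : ∀ q, 0 ≤ x q) (h : ∀ p, 0 ≤ cycSum v p) (p : ℚ × ℚ × ℚ) :
    x p.1 * x p.2.1 * x p.2.2 * cycSum v p ≤ 3 * cubic v x := by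
  rw [← cubic_eq_third_cycSum hv]
  have hb : ∀ p, ‖cycSum v p‖ ≤ C + C + C := fun p =>
    (norm_add₃_le).trans (add_le_add_three (hv _) (hv _) (hv _))
  refine (summable_cubic hb x).le_tsum p fun q _ => ?_
  exact mul_nonneg (mul_nonneg (mul_nonneg (hx _) (hx _)) (hx _)) (h q)

lemma cubic_nonneg_of_cycSum {v : ℚ × ℚ × ℚ → ℝ} {C : ℝ} (hv : ∀ p, ‖v p‖ ≤ C) {x : L1}
    (hx : ∀ q, 0 ≤ x q) (h : ∀ p, 0 ≤ cycSum v p) : 0 ≤ cubic v x := by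
  have := term_le_cubic hv hx h (0, 0, 0)
  have h2 := mul_nonneg (mul_nonneg (mul_nonneg (hx 0) (hx 0)) (hx 0)) (h (0, 0, 0))
  linarith

/-! ### Weights and pairings -/

/-- The weight relating the `ℓ¹` coordinates to the masses of the atoms. -/
def wt (k : ℕ) (q : ℚ) : ℝ := (1 + |(q : ℝ)|) ^ k + |(q : ℝ)|⁻¹

variable {k : ℕ}

lemma one_le_pow_wt (q : ℚ) : 1 ≤ (1 + |(q : ℝ)|) ^ k :=
  one_le_pow₀ (by linarith [abs_nonneg (q : ℝ)])

lemma one_le_wt (k : ℕ) (q : ℚ) : 1 ≤ wt k q := by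
  have h : 0 ≤ |(q : ℝ)|⁻¹ := by positivity
  unfold wt; linarith [one_le_pow_wt (k := k) q]

lemma wt_pos (k : ℕ) (q : ℚ) : 0 < wt k q := zero_lt_one.trans_le (one_le_wt k q)

lemma inv_sqrt_le_wt {q : ℚ} (hq : 0 < q) : (√(q : ℝ))⁻¹ ≤ wt k q := by
  have hq' : (0 : ℝ) < q := by exact_mod_cast hq
  rcases le_total 1 (q : ℝ) with h | h
  · exact (inv_le_one_of_one_le₀ (Real.one_le_sqrt.2 h)).trans (one_le_wt k q)
  · have h1 : (q : ℝ) ≤ √(q : ℝ) := Real.le_sqrt_of_sq_le (by nlinarith)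
    have h2 : (√(q : ℝ))⁻¹ ≤ (q : ℝ)⁻¹ := inv_anti₀ hq' h1
    have h3 : (q : ℝ)⁻¹ ≤ wt k q := by
      unfold wt; rw [abs_of_pos hq']; linarith [one_le_pow_wt (k := k) q, abs_of_pos hq' ▸ one_le_pow_wt (k := k) q]
    exact h2.trans h3

/-- A function on `ℚ` dominated by the weight. -/
def Tame (k : ℕ) (φ : ℚ → ℝ) : Prop := ∃ C, ∀ q, |φ q| ≤ C * wt k q

/-- The value of the measure encoded by `x` on the function `φ`. -/
def pair (k : ℕ) (φ : ℚ → ℝ) (x : L1) : ℝ := ∑' q, x q * (φ q / wt k q)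

lemma abs_div_wt_le {φ : ℚ → ℝ} {C : ℝ} (h : ∀ q, |φ q| ≤ C * wt k q) (q : ℚ) :
    |φ q / wt k q| ≤ C := by
  rw [abs_div, abs_of_pos (wt_pos k q), div_le_iff₀ (wt_pos k q)]; exact h q

lemma summable_pair {φ : ℚ → ℝ} (h : Tame k φ) (x : L1) :
    Summable fun q => x q * (φ q / wt k q) := by
  obtain ⟨C, hC⟩ := h
  exact summable_mul_of_bounded x (abs_div_wt_le hC)

lemma abs_pair_le {φ : ℚ → ℝ} {C : ℝ} (h : ∀ q, |φ q| ≤ C * wt k q) (x : L1) :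
    |pair k φ x| ≤ C * ‖x‖ := by
  rw [← Real.norm_eq_abs, mul_comm C]
  refine tsum_of_norm_bounded ((hasSum_abs x).mul_right C) fun q => ?_
  rw [norm_mul, Real.norm_eq_abs, Real.norm_eq_abs]
  gcongr
  exact abs_div_wt_le h q

/-- `pair` as a continuous linear functional. -/
def pairL (φ : ℚ → ℝ) (h : Tame k φ) : L1 →L[ℝ] ℝ :=
  LinearMap.mkContinuousOfExistsBound
    { toFun := pair k φ
      map_add' := fun x y => by
        unfold pair
        rw [← (summable_pair h x).tsum_add (summable_pair h y)]
        simp [add_mul]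
      map_smul' := fun c x => by
        unfold pair
        rw [RingHom.id_apply, smul_eq_mul, ← tsum_mul_left]
        simp [mul_assoc] }
    (h.imp fun _ hC x => abs_pair_le hC x)

@[simp] lemma pairL_apply (φ : ℚ → ℝ) (h : Tame k φ) (x : L1) : pairL φ h x = pair k φ x := rfl

lemma pair_add (φ : ℚ → ℝ) (h : Tame k φ) (x y : L1) :
    pair k φ (x + y) = pair k φ x + pair k φ y := (pairL φ h).map_add x y

lemma pair_sub (φ : ℚ → ℝ) (h : Tame k φ) (x y : L1) :
    pair k φ (x - y) = pair k φ x - pair k φ y := (pairL φ h).map_sub x y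

lemma pair_smul (φ : ℚ → ℝ) (h : Tame k φ) (c : ℝ) (x : L1) :
    pair k φ (c • x) = c * pair k φ x := (pairL φ h).map_smul c x

lemma tame_of_bounded {φ : ℚ → ℝ} {C : ℝ} (h : ∀ q, |φ q| ≤ C) : Tame k φ :=
  ⟨C, fun q => (h q).trans (le_mul_of_one_le_right ((abs_nonneg _).trans (h q)) (one_le_wt k q))⟩

lemma tame_one : Tame k fun _ => 1 := tame_of_bounded (C := 1) (by simp)

lemma tame_wt : Tame k (wt k) :=
  ⟨1, fun q => by rw [one_mul, abs_of_pos (wt_pos k q)]⟩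

lemma tame_id (hk : 1 ≤ k) : Tame k fun q => (q : ℝ) := by
  refine ⟨1, fun q => ?_⟩
  have h1 : (1 + |(q : ℝ)|) ≤ (1 + |(q : ℝ)|) ^ k :=
    le_self_pow₀ (by linarith [abs_nonneg (q : ℝ)]) (by omega)
  have h : 0 ≤ |(q : ℝ)|⁻¹ := by positivity
  unfold wt; linarith

lemma pair_wt_eq_norm {x : L1} (hx : ∀ q, 0 ≤ x q) : pair k (wt k) x = ‖x‖ := by
  rw [← (hasSum_abs x).tsum_eq]
  unfold pair
  congr 1 with q
  rw [div_self (wt_pos k q).ne', mul_one, abs_of_nonneg (hx q)]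

/-- The unit vector of `L1` at `q`. -/
def unitVec (q : ℚ) : L1 := lp.single 1 q (1 : ℝ)

lemma norm_unitVec (q : ℚ) : ‖unitVec q‖ = 1 := by
  simp [unitVec, lp.norm_single]

lemma unitVec_apply (q r : ℚ) : unitVec q r = if r = q then 1 else 0 := by
  simp [unitVec, lp.single_apply, Pi.single_apply]

lemma pair_unitVec (φ : ℚ → ℝ) (q : ℚ) : pair k φ (unitVec q) = φ q / wt k q := by
  unfold pair
  rw [tsum_eq_single q fun r hr => by simp [unitVec_apply, hr]]
  simp [unitVec_apply]

/-- The indicator of a single point, as a function on `ℚ`. -/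
def spike (r q : ℚ) : ℝ := if q = r then 1 else 0

lemma spike_nonneg (r q : ℚ) : 0 ≤ spike r q := by unfold spike; split_ifs <;> norm_num

lemma spike_le_one (r q : ℚ) : spike r q ≤ 1 := by unfold spike; split_ifs <;> norm_num

lemma abs_spike_le (r q : ℚ) : |spike r q| ≤ 1 := by
  rw [abs_of_nonneg (spike_nonneg r q)]; exact spike_le_one r q

lemma tame_spike (r : ℚ) : Tame k (spike r) := tame_of_bounded (abs_spike_le r)

lemma pair_spike (x : L1) (r : ℚ) : pair k (spike r) x = x r / wt k r := by
  unfold pair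
  rw [tsum_eq_single r fun q hq => by simp [spike, hq]]
  simp [spike, div_eq_mul_inv]

lemma pair_mono {φ ψ : ℚ → ℝ} (hφ : Tame k φ) (hψ : Tame k ψ) {x : L1} (hx : ∀ q, 0 ≤ x q)
    (h : ∀ q, x q ≠ 0 → φ q ≤ ψ q) : pair k φ x ≤ pair k ψ x := by
  refine (summable_pair hφ x).tsum_le_tsum (fun q => ?_) (summable_pair hψ x)
  by_cases hq : x q = 0
  · simp [hq]
  · exact mul_le_mul_of_nonneg_left (div_le_div_of_nonneg_right (h q hq) (wt_pos k q).le) (hx q)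

lemma pair_congr {φ ψ : ℚ → ℝ} {x : L1} (h : ∀ q, x q ≠ 0 → φ q = ψ q) :
    pair k φ x = pair k ψ x := by
  unfold pair
  congr 1 with q
  by_cases hq : x q = 0
  · simp [hq]
  · rw [h q hq]

lemma pair_nonneg {φ : ℚ → ℝ} {x : L1} (hx : ∀ q, 0 ≤ x q) (h : ∀ q, 0 ≤ φ q) :
    0 ≤ pair k φ x :=
  tsum_nonneg fun q => mul_nonneg (hx q) (div_nonneg (h q) (wt_pos k q).le)

/-! ### The collision kernel on rational frequencies -/

/-- The collision kernel divided by the square roots of the frequencies. -/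
def ker (p : ℚ × ℚ × ℚ) : ℝ :=
  PhiKer 0 p.1 p.2.1 p.2.2 / √((p.1 : ℝ) * p.2.1 * p.2.2)

/-- The fourth frequency in a collision. -/
def out (p : ℚ × ℚ × ℚ) : ℚ := p.1 + p.2.1 - p.2.2

/-- The increment of a test function in a collision. -/
def br (φ : ℚ → ℝ) (p : ℚ × ℚ × ℚ) : ℝ := φ (out p) + φ p.2.2 - φ p.1 - φ p.2.1

lemma Phi4_nonneg (σ a b c d : ℝ) : 0 ≤ Phi4 σ a b c d := by unfold Phi4; positivity

lemma PhiKer_nonneg (σ a b c : ℝ) : 0 ≤ PhiKer σ a b c := by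
  unfold PhiKer; split_ifs
  · exact Phi4_nonneg _ _ _ _ _
  · exact le_rfl

lemma PhiKer_zero_le_sqrt (a b c : ℝ) : PhiKer 0 a b c ≤ √(max a 0) := by
  unfold PhiKer Phi4; split_ifs
  · simp only [sub_zero]
    exact (min_le_left _ _).trans (min_le_left _ _)
  · positivity

lemma pos_of_PhiKer_ne_zero {a b c : ℝ} (h : PhiKer 0 a b c ≠ 0) :
    0 < a ∧ 0 < b ∧ 0 < c ∧ 0 < a + b - c := by
  have h' : 0 < PhiKer 0 a b c := lt_of_le_of_ne (PhiKer_nonneg _ _ _ _) h.symm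
  unfold PhiKer Phi4 at h'
  split_ifs at h' with h0
  · simp only [sub_zero, lt_min_iff, Real.sqrt_pos, lt_max_iff, lt_irrefl, or_false] at h'
    tauto
  · exact absurd h' (lt_irrefl _)

lemma ker_nonneg (p : ℚ × ℚ × ℚ) : 0 ≤ ker p :=
  div_nonneg (PhiKer_nonneg _ _ _ _) (Real.sqrt_nonneg _)

lemma pos_of_ker_ne_zero {p : ℚ × ℚ × ℚ} (h : ker p ≠ 0) :
    0 < p.1 ∧ 0 < p.2.1 ∧ 0 < p.2.2 ∧ 0 < out p := by
  have h' : PhiKer 0 (p.1 : ℝ) p.2.1 p.2.2 ≠ 0 := fun h0 => h (by simp [ker, h0])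
  have := pos_of_PhiKer_ne_zero h'
  unfold out
  exact_mod_cast this

lemma ker_le_inv_sqrt {p : ℚ × ℚ × ℚ} (h1 : 0 < p.1) :
    ker p ≤ (√(p.2.1 : ℝ))⁻¹ * (√(p.2.2 : ℝ))⁻¹ := by
  by_cases h : ker p = 0
  · rw [h]; positivity
  obtain ⟨-, h2, h3, -⟩ := pos_of_ker_ne_zero h
  have e1 : (0 : ℝ) < p.1 := by exact_mod_cast h1
  have e2 : (0 : ℝ) < p.2.1 := by exact_mod_cast h2
  have e3 : (0 : ℝ) < p.2.2 := by exact_mod_cast h3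
  have hle := PhiKer_zero_le_sqrt p.1 p.2.1 p.2.2
  rw [max_eq_left e1.le] at hle
  unfold ker
  rw [Real.sqrt_mul (by positivity), Real.sqrt_mul e1.le, ← mul_inv]
  have s1 := Real.sqrt_pos.2 e1
  have s2 := Real.sqrt_pos.2 e2
  have s3 := Real.sqrt_pos.2 e3
  rw [div_le_iff₀ (by positivity)]
  refine hle.trans (le_of_eq ?_)
  field_simp

lemma ker_le_wt (k : ℕ) (p : ℚ × ℚ × ℚ) : ker p ≤ wt k p.1 * wt k p.2.1 * wt k p.2.2 := by
  have hw1 := one_le_wt k p.1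
  have hw2 := wt_pos k p.2.1
  have hw3 := wt_pos k p.2.2
  by_cases h : ker p = 0
  · rw [h]; positivity
  obtain ⟨h1, h2, h3, -⟩ := pos_of_ker_ne_zero h
  refine (ker_le_inv_sqrt h1).trans ?_
  rw [mul_assoc]
  refine (mul_le_mul (inv_sqrt_le_wt (k := k) h2) (inv_sqrt_le_wt (k := k) h3)
    (by positivity) hw2.le).trans ?_
  exact le_mul_of_one_le_left (by positivity) hw1

/-- The product of the weights of a triple. -/
def wt3 (k : ℕ) (p : ℚ × ℚ × ℚ) : ℝ := wt k p.1 * wt k p.2.1 * wt k p.2.2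

lemma wt3_pos (k : ℕ) (p : ℚ × ℚ × ℚ) : 0 < wt3 k p :=
  mul_pos (mul_pos (wt_pos _ _) (wt_pos _ _)) (wt_pos _ _)

lemma abs_br_le {φ : ℚ → ℝ} {C : ℝ} (h : ∀ q, |φ q| ≤ C) (p : ℚ × ℚ × ℚ) :
    |br φ p| ≤ 4 * C := by
  have h1 := abs_le.1 (h (out p))
  have h2 := abs_le.1 (h p.2.2)
  have h3 := abs_le.1 (h p.1)
  have h4 := abs_le.1 (h p.2.1)
  unfold br
  rw [abs_le]; constructor <;> linarith

lemma norm_ker_br_le {φ : ℚ → ℝ} {C : ℝ} (h : ∀ q, |φ q| ≤ C) (p : ℚ × ℚ × ℚ) :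
    ‖ker p / wt3 k p * br φ p‖ ≤ 4 * C := by
  rw [norm_mul, Real.norm_eq_abs, Real.norm_eq_abs, abs_of_nonneg
    (div_nonneg (ker_nonneg p) (wt3_pos k p).le)]
  have h1 : ker p / wt3 k p ≤ 1 := (div_le_one (wt3_pos k p)).2 (ker_le_wt k p)
  calc _ ≤ 1 * (4 * C) := mul_le_mul h1 (abs_br_le h p) (abs_nonneg _) zero_le_one
    _ = _ := one_mul _


/-! ### Dyadic grids -/

/-- The spacing of the dyadic grid of level `N`. -/
def mesh (N : ℕ) : ℚ := (2 ^ N)⁻¹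

lemma mesh_pos (N : ℕ) : 0 < mesh N := by unfold mesh; positivity

lemma mesh_cast_pos (N : ℕ) : (0 : ℝ) < mesh N := by exact_mod_cast mesh_pos N

lemma two_mul_mesh_succ (N : ℕ) : 2 * mesh (N + 1) = mesh N := by
  unfold mesh; rw [pow_succ]; field_simp

lemma mesh_cast (N : ℕ) : ((mesh N : ℚ) : ℝ) = (2 ^ N)⁻¹ := by simp [mesh]

/-- The positive multiples of `mesh N`. -/
def grid (N : ℕ) : Set ℚ := {q | 0 < q ∧ ∃ n : ℤ, q = n * mesh N}

lemma pos_of_mem_grid {q : ℚ} (h : q ∈ grid N) : 0 < q := h.1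

lemma mesh_mem_grid (N : ℕ) : mesh N ∈ grid N := ⟨mesh_pos N, 1, by simp⟩

lemma grid_subset_succ (N : ℕ) : grid N ⊆ grid (N + 1) := by
  rintro q ⟨h, n, rfl⟩
  refine ⟨h, 2 * n, ?_⟩
  rw [← two_mul_mesh_succ]; push_cast; ring

lemma add_sub_mem_grid {a b c : ℚ} (ha : a ∈ grid N) (hb : b ∈ grid N) (hc : c ∈ grid N)
    (h : 0 < a + b - c) : a + b - c ∈ grid N := by
  obtain ⟨-, n, rfl⟩ := ha
  obtain ⟨-, m, rfl⟩ := hb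
  obtain ⟨-, l, rfl⟩ := hc
  exact ⟨h, n + m - l, by push_cast; ring⟩

lemma grid_cases {q : ℚ} (h : q ∈ grid N) : q = mesh N ∨ q = 2 * mesh N ∨ 3 * mesh N ≤ q := by
  obtain ⟨h, n, rfl⟩ := h
  have hm := mesh_pos N
  have hn : 0 < (n : ℚ) := pos_of_mul_pos_left h hm.le
  have hn' : 0 < n := by exact_mod_cast hn
  obtain rfl | rfl | h3 : n = 1 ∨ n = 2 ∨ 3 ≤ n := by omega
  · left; simp
  · right; left; norm_num
  · right; right
    have : (3 : ℚ) ≤ n := by exact_mod_cast h3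
    gcongr

lemma two_mesh_le_of_ne {q : ℚ} (h : q ∈ grid N) (hq : q ≠ mesh N) : 2 * mesh N ≤ q := by
  have hm := mesh_pos N
  rcases grid_cases h with h | h | h
  · exact absurd h hq
  · exact h.ge
  · linarith

lemma mesh_le_of_mem {q : ℚ} (h : q ∈ grid N) : mesh N ≤ q := by
  have hm := mesh_pos N
  rcases grid_cases h with h | h | h <;> linarith

lemma mesh_succ_notMem (N : ℕ) : mesh (N + 1) ∉ grid N := fun h => by
  have h1 := mesh_le_of_mem h
  have h2 := two_mul_mesh_succ N
  have h3 := mesh_pos (N + 1)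
  linarith

/-! ### The truncated collision operator -/

/-- Triples of grid points. -/
def triples (N : ℕ) : Set (ℚ × ℚ × ℚ) := {p | p.1 ∈ grid N ∧ p.2.1 ∈ grid N ∧ p.2.2 ∈ grid N}

/-- The collision coefficient restricted to the grid, normalized by the weights. -/
def coef (k N : ℕ) : ℚ × ℚ × ℚ → ℝ := (triples N).indicator fun p => ker p / wt3 k p

lemma coef_nonneg (p : ℚ × ℚ × ℚ) : 0 ≤ coef k N p :=
  Set.indicator_nonneg (fun p _ => div_nonneg (ker_nonneg p) (wt3_pos k p).le) p

lemma mem_of_coef_ne_zero {p : ℚ × ℚ × ℚ} (h : coef k N p ≠ 0) :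
    p.1 ∈ grid N ∧ p.2.1 ∈ grid N ∧ p.2.2 ∈ grid N ∧ out p ∈ grid N := by
  have hp : p ∈ triples N := Set.mem_of_indicator_ne_zero h
  refine ⟨hp.1, hp.2.1, hp.2.2, add_sub_mem_grid hp.1 hp.2.1 hp.2.2 ?_⟩
  have : ker p ≠ 0 := fun h0 => h (by simp [coef, Set.indicator, h0])
  exact (pos_of_ker_ne_zero this).2.2.2

lemma inv_sqrt_le_of_mem {q : ℚ} (h : q ∈ grid N) : (√(q : ℝ))⁻¹ ≤ (√(mesh N : ℝ))⁻¹ := by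
  have h1 := Real.sqrt_pos.2 (mesh_cast_pos N)
  have h2 : (mesh N : ℝ) ≤ q := by exact_mod_cast mesh_le_of_mem h
  exact inv_anti₀ h1 (Real.sqrt_le_sqrt h2)

lemma coef_le (p : ℚ × ℚ × ℚ) : coef k N p ≤ 2 ^ N / wt3 k p := by
  by_cases h : coef k N p = 0
  · rw [h]; have := wt3_pos k p; positivity
  obtain ⟨h1, h2, h3, -⟩ := mem_of_coef_ne_zero h
  have hp : p ∈ triples N := ⟨h1, h2, h3⟩
  rw [coef, Set.indicator_of_mem hp]
  refine div_le_div_of_nonneg_right ?_ (wt3_pos k p).le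
  refine (ker_le_inv_sqrt h1.1).trans ((mul_le_mul (inv_sqrt_le_of_mem h2)
    (inv_sqrt_le_of_mem h3) (by positivity) (by positivity)).trans (le_of_eq ?_))
  rw [← mul_inv, Real.mul_self_sqrt (mesh_cast_pos N).le, mesh_cast, inv_inv]

lemma wt_out_le {p : ℚ × ℚ × ℚ} (h : coef k N p ≠ 0) :
    wt k (out p) ≤ (2 ^ k + 2 ^ N) * (wt k p.1 + wt k p.2.1) := by
  obtain ⟨h1, h2, h3, h4⟩ := mem_of_coef_ne_zero h
  have e1 : (0 : ℝ) < p.1 := by exact_mod_cast h1.1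
  have e2 : (0 : ℝ) < p.2.1 := by exact_mod_cast h2.1
  have e3 : (0 : ℝ) < p.2.2 := by exact_mod_cast h3.1
  have e4 : (0 : ℝ) < out p := by exact_mod_cast h4.1
  have e5 : ((out p : ℚ) : ℝ) = p.1 + p.2.1 - p.2.2 := by simp [out]
  have p1 := inv_pos.2 e1
  have p2 := inv_pos.2 e2
  have k1 : (1 + (p.1 : ℝ)) ^ k ≤ wt k p.1 := by unfold wt; rw [abs_of_pos e1]; linarith
  have k2 : (1 + (p.2.1 : ℝ)) ^ k ≤ wt k p.2.1 := by unfold wt; rw [abs_of_pos e2]; linarith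
  have w1 := one_le_wt k p.1
  have w2 := one_le_wt k p.2.1
  have a1 : (1 + ((out p : ℚ) : ℝ)) ^ k ≤ 2 ^ k * (wt k p.1 + wt k p.2.1) := by
    rcases le_total (p.1 : ℝ) p.2.1 with hle | hle
    · calc (1 + ((out p : ℚ) : ℝ)) ^ k ≤ (2 * (1 + (p.2.1 : ℝ))) ^ k := by
            apply pow_le_pow_left₀ <;> linarith
        _ = 2 ^ k * (1 + (p.2.1 : ℝ)) ^ k := mul_pow _ _ _
        _ ≤ _ := by gcongr; linarith
    · calc (1 + ((out p : ℚ) : ℝ)) ^ k ≤ (2 * (1 + (p.1 : ℝ))) ^ k := by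
            apply pow_le_pow_left₀ <;> linarith
        _ = 2 ^ k * (1 + (p.1 : ℝ)) ^ k := mul_pow _ _ _
        _ ≤ _ := by gcongr; linarith
  have a2 : ((out p : ℚ) : ℝ)⁻¹ ≤ 2 ^ N * (wt k p.1 + wt k p.2.1) := by
    have : (mesh N : ℝ) ≤ out p := by exact_mod_cast mesh_le_of_mem h4
    calc ((out p : ℚ) : ℝ)⁻¹ ≤ (mesh N : ℝ)⁻¹ := inv_anti₀ (mesh_cast_pos N) this
      _ = 2 ^ N := by rw [mesh_cast, inv_inv]
      _ ≤ _ := le_mul_of_one_le_right (by positivity) (by linarith)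
  calc wt k (out p) = (1 + ((out p : ℚ) : ℝ)) ^ k + ((out p : ℚ) : ℝ)⁻¹ := by
        unfold wt; rw [abs_of_pos e4]
    _ ≤ _ := by linarith

/-- The growth constant of the operator of level `N`. -/
def growth (k N : ℕ) : ℝ := 2 ^ N * (2 * (2 ^ k + 2 ^ N) + 3)

lemma growth_pos : 0 < growth k N := by unfold growth; positivity

/-- The elementary change of the state produced by a collision. -/
def vec (k N : ℕ) (p : ℚ × ℚ × ℚ) : L1 :=
  coef k N p • (wt k (out p) • unitVec (out p) + wt k p.2.2 • unitVec p.2.2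
    - wt k p.1 • unitVec p.1 - wt k p.2.1 • unitVec p.2.1)

lemma norm_vec_le (p : ℚ × ℚ × ℚ) : ‖vec k N p‖ ≤ growth k N := by
  by_cases h : coef k N p = 0
  · rw [vec, h, zero_smul, norm_zero]; exact growth_pos.le
  have w1 := one_le_wt k p.1
  have w2 := one_le_wt k p.2.1
  have w3 := one_le_wt k p.2.2
  have ho := wt_out_le h
  have hn : ∀ q : ℚ, ‖wt k q • unitVec q‖ = wt k q := fun q => by
    rw [norm_smul, norm_unitVec, mul_one, Real.norm_eq_abs, abs_of_pos (wt_pos k q)]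
  have h3 := wt3_pos k p
  have b1 : wt k p.1 ≤ wt3 k p := by
    unfold wt3; nlinarith [mul_le_mul w2 w3 zero_le_one (by linarith)]
  have b2 : wt k p.2.1 ≤ wt3 k p := by
    unfold wt3; nlinarith [mul_le_mul w1 w3 zero_le_one (by linarith)]
  have b3 : wt k p.2.2 ≤ wt3 k p := by
    unfold wt3; nlinarith [mul_le_mul w1 w2 zero_le_one (by linarith)]
  rw [vec, norm_smul, Real.norm_eq_abs, abs_of_nonneg (coef_nonneg p)]
  have hin : ‖wt k (out p) • unitVec (out p) + wt k p.2.2 • unitVec p.2.2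
    - wt k p.1 • unitVec p.1 - wt k p.2.1 • unitVec p.2.1‖
      ≤ (2 * (2 ^ k + 2 ^ N) + 3) * wt3 k p := by
    refine (norm_sub_le _ _).trans ?_
    refine (add_le_add_left ((norm_sub_le _ _).trans
      (add_le_add_left (norm_add_le _ _) _)) _).trans ?_
    rw [hn, hn, hn, hn]
    have : (2 ^ k + 2 ^ N) * (wt k p.1 + wt k p.2.1) ≤ (2 ^ k + 2 ^ N) * (wt3 k p + wt3 k p) := by
      gcongr
    linarith
  calc _ ≤ 2 ^ N / wt3 k p * ((2 * (2 ^ k + 2 ^ N) + 3) * wt3 k p) :=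
        mul_le_mul (coef_le p) hin (norm_nonneg _) (by positivity)
    _ = growth k N := by unfold growth; field_simp

lemma pair_vec {φ : ℚ → ℝ} (h : Tame k φ) (p : ℚ × ℚ × ℚ) :
    pair k φ (vec k N p) = coef k N p * br φ p := by
  have e : ∀ q : ℚ, wt k q * (φ q / wt k q) = φ q := fun q => by
    field_simp [(wt_pos k q).ne']
  rw [vec, pair_smul _ h, pair_sub _ h, pair_sub _ h, pair_add _ h, pair_smul _ h, pair_smul _ h,
    pair_smul _ h, pair_smul _ h, pair_unitVec, pair_unitVec, pair_unitVec, pair_unitVec,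
    e, e, e, e, br]

lemma norm_coef_br_le {φ : ℚ → ℝ} (h : Tame k φ) (p : ℚ × ℚ × ℚ) :
    ‖coef k N p * br φ p‖ ≤ ‖pairL φ h‖ * growth k N := by
  rw [← pair_vec h, ← pairL_apply φ h]
  exact ((pairL φ h).le_opNorm _).trans (mul_le_mul_of_nonneg_left (norm_vec_le p) (norm_nonneg _))

/-- The collision operator on the grid of level `N`. -/
def Q (k N : ℕ) : L1 → L1 := cubic (vec k N)

lemma pair_Q {φ : ℚ → ℝ} (h : Tame k φ) (x : L1) :
    pair k φ (Q k N x) = cubic (fun p => coef k N p * br φ p) x := by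
  rw [← pairL_apply φ h, Q, map_cubic norm_vec_le]
  simp only [pairL_apply, pair_vec h]

lemma pair_Q_of_br_eq_zero {φ : ℚ → ℝ} (h : Tame k φ) (h0 : ∀ p, br φ p = 0) (x : L1) :
    pair k φ (Q k N x) = 0 := by
  rw [pair_Q h]; simp [cubic, h0]

lemma pair_one_Q (x : L1) : pair k (fun _ => 1) (Q k N x) = 0 :=
  pair_Q_of_br_eq_zero tame_one (fun p => by simp [br]) x

lemma pair_id_Q (hk : 1 ≤ k) (x : L1) : pair k (fun q => (q : ℝ)) (Q k N x) = 0 :=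
  pair_Q_of_br_eq_zero (tame_id hk) (fun p => by simp [br, out]) x

lemma apply_eq_pair_spike (x : L1) (r : ℚ) : x r = wt k r * pair k (spike r) x := by
  rw [pair_spike]; field_simp [(wt_pos k r).ne']

lemma Q_apply_eq_zero {r : ℚ} (hr : r ∉ grid N) (x : L1) : Q k N x r = 0 := by
  rw [apply_eq_pair_spike (k := k), pair_Q (tame_spike r)]
  have : ∀ p, coef k N p * br (spike r) p = 0 := fun p => by
    by_cases h : coef k N p = 0
    · rw [h, zero_mul]
    obtain ⟨h1, h2, h3, h4⟩ := mem_of_coef_ne_zero h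
    have e : ∀ q ∈ grid N, spike r q = 0 := fun q hq => if_neg (by rintro rfl; exact hr hq)
    simp [br, e _ h1, e _ h2, e _ h3, e _ h4]
  simp [cubic, this]

lemma Q_apply_nonneg {x : L1} (hx : ∀ q, 0 ≤ x q) {r : ℚ} (hr : x r = 0) : 0 ≤ Q k N x r := by
  rw [apply_eq_pair_spike (k := k), pair_Q (tame_spike r)]
  refine mul_nonneg (wt_pos k r).le (tsum_nonneg fun p => ?_)
  rw [smul_eq_mul]
  by_cases h1 : p.1 = r
  · simp [h1, hr]
  by_cases h2 : p.2.1 = r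
  · simp [h2, hr]
  refine mul_nonneg (mul_nonneg (mul_nonneg (hx _) (hx _)) (hx _)) (mul_nonneg (coef_nonneg p) ?_)
  have e1 : spike r p.1 = 0 := if_neg h1
  have e2 : spike r p.2.1 = 0 := if_neg h2
  rw [br, e1, e2]
  linarith [spike_nonneg r (out p), spike_nonneg r p.2.2]

lemma pair_wt_Q_le {x : L1} (hx : ∀ q, 0 ≤ x q) :
    pair k (wt k) (Q k N x) ≤ growth k N * pair k (fun _ => 1) x ^ 2 * ‖x‖ := by
  have hs : HasSum (fun q => x q) ‖x‖ := by
    have := hasSum_abs x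
    simpa only [abs_of_nonneg (hx _)] using this
  have hm : HasSum (fun q => x q * (1 / wt k q)) (pair k (fun _ => 1) x) :=
    (summable_pair tame_one x).hasSum
  have hR := ((((hasSum_mul_three hs hm hm).add (hasSum_mul_three hm hs hm)).mul_left
    (2 ^ k + 2 ^ N : ℝ)).add (hasSum_mul_three hm hm hs)).mul_left ((2 : ℝ) ^ N)
  have hM : 0 ≤ pair k (fun _ => 1) x := pair_nonneg hx fun _ => zero_le_one
  rw [pair_Q tame_wt]
  refine (hasSum_le (fun p => ?_)
    (summable_cubic (norm_coef_br_le (N := N) tame_wt) x).hasSum hR).trans ?_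
  · have w1 := wt_pos k p.1
    have w2 := wt_pos k p.2.1
    have w3 := wt_pos k p.2.2
    have hX : 0 ≤ x p.1 * x p.2.1 * x p.2.2 := mul_nonneg (mul_nonneg (hx _) (hx _)) (hx _)
    have key : coef k N p * br (wt k) p
        ≤ 2 ^ N / wt3 k p * ((2 ^ k + 2 ^ N) * (wt k p.1 + wt k p.2.1) + wt k p.2.2) := by
      by_cases h : coef k N p = 0
      · rw [h, zero_mul]; have := wt3_pos k p; positivity
      have h3 := wt3_pos k p
      have ho := wt_out_le h
      have hb : br (wt k) p ≤ (2 ^ k + 2 ^ N) * (wt k p.1 + wt k p.2.1) + wt k p.2.2 := by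
        unfold br; linarith
      exact (mul_le_mul_of_nonneg_left hb (coef_nonneg p)).trans
        (mul_le_mul_of_nonneg_right (coef_le p) (by positivity))
    refine (mul_le_mul_of_nonneg_left key hX).trans (le_of_eq ?_)
    unfold wt3
    field_simp
  · unfold growth
    have : 0 ≤ pair k (fun _ => 1) x ^ 2 * ‖x‖ := by positivity
    nlinarith [mul_nonneg (pow_nonneg zero_le_two N : (0 : ℝ) ≤ 2 ^ N) this]

lemma coef_eq_ker {p : ℚ × ℚ × ℚ} (h : p ∈ triples N) : coef k N p = ker p / wt3 k p :=
  Set.indicator_of_mem h _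

/-- A sequence supported in the grid of level `N`. -/
def Supp (N : ℕ) (x : L1) : Prop := ∀ q ∉ grid N, x q = 0

lemma Supp.mem {x : L1} (hx : Supp N x) {q : ℚ} (h : x q ≠ 0) : q ∈ grid N :=
  not_not.1 fun h' => h (hx q h')

lemma Supp.succ {x : L1} (hx : Supp N x) : Supp (N + 1) x :=
  fun q hq => hx q fun h => hq (grid_subset_succ N h)

lemma cubic_congr {Y : Type*} [NormedAddCommGroup Y] [NormedSpace ℝ Y] {V W : ℚ × ℚ × ℚ → Y}
    {x : L1} (hx : Supp N x) (h : ∀ p ∈ triples N, V p = W p) : cubic V x = cubic W x := by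
  unfold cubic
  congr 1 with p
  by_cases h1 : x p.1 = 0
  · simp [h1]
  by_cases h2 : x p.2.1 = 0
  · simp [h2]
  by_cases h3 : x p.2.2 = 0
  · simp [h3]
  rw [h p ⟨hx.mem h1, hx.mem h2, hx.mem h3⟩]

lemma Q_succ {x : L1} (hx : Supp N x) : Q k (N + 1) x = Q k N x := by
  refine cubic_congr hx fun p hp => ?_
  have hp' : p ∈ triples (N + 1) :=
    ⟨grid_subset_succ N hp.1, grid_subset_succ N hp.2.1, grid_subset_succ N hp.2.2⟩
  rw [vec, vec, coef_eq_ker hp, coef_eq_ker hp']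

lemma pair_Q_eq_ker {φ : ℚ → ℝ} (h : Tame k φ) {x : L1} (hx : Supp N x) :
    pair k φ (Q k N x) = cubic (fun p => ker p / wt3 k p * br φ p) x := by
  rw [pair_Q h]
  exact cubic_congr hx fun p hp => by rw [coef_eq_ker hp]

/-! ### Concentration towards low frequencies -/

/-- The convex function `q ↦ (c - q)₊`. -/
def ramp (c q : ℝ) : ℝ := max (c - q) 0

lemma ramp_nonneg (c q : ℝ) : 0 ≤ ramp c q := le_max_right _ _

lemma ramp_of_le {c q : ℝ} (h : c ≤ q) : ramp c q = 0 := max_eq_right (by linarith)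

lemma ramp_of_ge {c q : ℝ} (h : q ≤ c) : ramp c q = c - q := max_eq_left (by linarith)

lemma sub_le_ramp (c q : ℝ) : c - q ≤ ramp c q := le_max_left _ _

lemma two_ramp_le (c z d : ℝ) : 2 * ramp c z ≤ ramp c (z + d) + ramp c (z - d) := by
  have h1 := sub_le_ramp c (z + d)
  have h2 := sub_le_ramp c (z - d)
  have h3 := ramp_nonneg c (z + d)
  have h4 := ramp_nonneg c (z - d)
  rcases le_total c z with h | h
  · rw [ramp_of_le h]; linarith
  · rw [ramp_of_ge h]; linarith

lemma ramp_add_le {c x y z : ℝ} (hxy : x ≤ y) (hyz : y ≤ z) :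
    ramp c x + ramp c y ≤ ramp c (x + y - z) + ramp c z := by
  have h1 := sub_le_ramp c (x + y - z)
  have h2 := sub_le_ramp c z
  have h3 := ramp_nonneg c (x + y - z)
  have h4 := ramp_nonneg c z
  rcases le_total c x with hx | hx <;> rcases le_total c y with hy | hy
  · rw [ramp_of_le hx, ramp_of_le hy]; linarith
  · rw [ramp_of_le hx, ramp_of_ge hy]; linarith
  · rw [ramp_of_ge hx, ramp_of_le hy]; linarith
  · rw [ramp_of_ge hx, ramp_of_ge hy]; linarith

lemma PhiKer_eq_sqrt_left {a b c : ℝ} (ha : 0 < a) (hb : a ≤ b) (hc : c ≤ b) (hac : a ≤ c) :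
    PhiKer 0 a b c = √a := by
  rw [PhiKer, if_pos (by linarith), Phi4]
  simp only [sub_zero]
  rw [max_eq_left ha.le, max_eq_left (by linarith), max_eq_left (by linarith),
    max_eq_left (by linarith), min_eq_left (Real.sqrt_le_sqrt hb)]
  exact min_eq_left (le_min (Real.sqrt_le_sqrt hac) (Real.sqrt_le_sqrt (by linarith)))

lemma PhiKer_eq_sqrt_right {a b c : ℝ} (hc : 0 < c) (ha : c ≤ a) (hb : c ≤ b) :
    PhiKer 0 a b c = √c := by
  rw [PhiKer, if_pos (by linarith), Phi4]
  simp only [sub_zero]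
  rw [max_eq_left (by linarith), max_eq_left (by linarith), max_eq_left (by linarith),
    max_eq_left (by linarith)]
  exact le_antisymm ((min_le_right _ _).trans (min_le_left _ _))
    (le_min (le_min (Real.sqrt_le_sqrt ha) (Real.sqrt_le_sqrt hb))
      (le_min le_rfl (Real.sqrt_le_sqrt (by linarith))))

lemma PhiKer_comm (σ a b c : ℝ) : PhiKer σ a b c = PhiKer σ b a c := by
  unfold PhiKer Phi4
  rw [add_comm a b, min_comm (√(max (a - σ) 0))]

/-- One collision term for the test function `ramp c`. -/
def rampTerm (c x y z : ℝ) : ℝ :=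
  PhiKer 0 x y z * (ramp c (x + y - z) + ramp c z - ramp c x - ramp c y)

lemma rampTerm_comm (c x y z : ℝ) : rampTerm c x y z = rampTerm c y x z := by
  unfold rampTerm; rw [PhiKer_comm, add_comm x y]; ring

lemma rampTerm_sum_nonneg_of_le {c x y z : ℝ} (hx : 0 < x) (hxy : x ≤ y) (hyz : y ≤ z) :
    0 ≤ rampTerm c x y z + rampTerm c y z x + rampTerm c z x y := by
  have h1 : 0 ≤ rampTerm c x y z :=
    mul_nonneg (PhiKer_nonneg _ _ _ _) (by linarith [ramp_add_le (c := c) hxy hyz])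
  have h2 : rampTerm c y z x + rampTerm c z x y
      = √x * (ramp c (z + (y - x)) + ramp c (z - (y - x)) - 2 * ramp c z) := by
    rw [rampTerm_comm c z x y]
    unfold rampTerm
    rw [PhiKer_eq_sqrt_right hx hxy (hxy.trans hyz), PhiKer_eq_sqrt_left hx (hxy.trans hyz) hyz hxy,
      show y + z - x = z + (y - x) by ring, show x + z - y = z - (y - x) by ring]
    ring
  have h3 := two_ramp_le c z (y - x)
  have h4 : 0 ≤ √x * (ramp c (z + (y - x)) + ramp c (z - (y - x)) - 2 * ramp c z) :=
    mul_nonneg (Real.sqrt_nonneg x) (by linarith)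
  linarith

lemma rampTerm_sum_nonneg {c x y z : ℝ} (hx : 0 < x) (hy : 0 < y) (hz : 0 < z) :
    0 ≤ rampTerm c x y z + rampTerm c y z x + rampTerm c z x y := by
  have c1 := rampTerm_comm c x y z
  have c2 := rampTerm_comm c y z x
  have c3 := rampTerm_comm c z x y
  rcases le_total x y with h1 | h1 <;> rcases le_total y z with h2 | h2 <;>
    rcases le_total x z with h3 | h3
  · linarith [rampTerm_sum_nonneg_of_le (c := c) hx h1 h2]
  · linarith [rampTerm_sum_nonneg_of_le (c := c) hx h1 h2]
  · linarith [rampTerm_sum_nonneg_of_le (c := c) hx h3 h2]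
  · linarith [rampTerm_sum_nonneg_of_le (c := c) hz h3 h1]
  · linarith [rampTerm_sum_nonneg_of_le (c := c) hy h1 h3]
  · linarith [rampTerm_sum_nonneg_of_le (c := c) hy h2 h3]
  · linarith [rampTerm_sum_nonneg_of_le (c := c) hz h2 h1]
  · linarith [rampTerm_sum_nonneg_of_le (c := c) hz h2 h1]

/-- `ramp c` as a function on `ℚ`. -/
def rampQ (c : ℝ) (q : ℚ) : ℝ := ramp c q

lemma tame_rampQ (hk : 1 ≤ k) (c : ℝ) : Tame k (rampQ c) := by
  obtain ⟨C, hC⟩ := tame_id hk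
  refine ⟨|c| + C, fun q => ?_⟩
  have h : |(q : ℝ)| ≤ C * wt k q := hC q
  have h1 := one_le_wt k q
  have h2 : |c| ≤ |c| * wt k q := le_mul_of_one_le_right (abs_nonneg c) h1
  have h3 := le_abs_self c
  have h4 := neg_abs_le (q : ℝ)
  have h5 := abs_nonneg (q : ℝ)
  have h6 := abs_nonneg c
  rw [rampQ, abs_of_nonneg (ramp_nonneg _ _), ramp, add_mul]
  exact max_le (by linarith) (by linarith)

lemma cycSum_ramp (c : ℝ) {p : ℚ × ℚ × ℚ} (hp : p ∈ triples N) :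
    cycSum (fun p => coef k N p * br (rampQ c) p) p
      = (rampTerm c p.1 p.2.1 p.2.2 + rampTerm c p.2.1 p.2.2 p.1 + rampTerm c p.2.2 p.1 p.2.1)
        / (√((p.1 : ℝ) * p.2.1 * p.2.2) * wt3 k p) := by
  obtain ⟨h1, h2, h3⟩ := hp
  simp only [cycSum]
  rw [coef_eq_ker ⟨h1, h2, h3⟩, coef_eq_ker (show cyc p ∈ triples N from ⟨h2, h3, h1⟩),
    coef_eq_ker (show cyc (cyc p) ∈ triples N from ⟨h3, h1, h2⟩)]
  have w1 : wt3 k (cyc p) = wt3 k p := by simp only [wt3, cyc, Equiv.coe_fn_mk]; ring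
  have w2 : wt3 k (cyc (cyc p)) = wt3 k p := by simp only [wt3, cyc, Equiv.coe_fn_mk]; ring
  rw [w1, w2]
  simp only [ker, br, rampQ, rampTerm, out, cyc, Equiv.coe_fn_mk]
  rw [show (p.2.1 : ℝ) * p.2.2 * p.1 = p.1 * p.2.1 * p.2.2 by ring,
    show (p.2.2 : ℝ) * p.1 * p.2.1 = p.1 * p.2.1 * p.2.2 by ring]
  push_cast
  simp only [div_eq_mul_inv, mul_inv]
  ring

lemma cycSum_ramp_nonneg (c : ℝ) (p : ℚ × ℚ × ℚ) :
    0 ≤ cycSum (fun p => coef k N p * br (rampQ c) p) p := by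
  by_cases hp : p ∈ triples N
  · rw [cycSum_ramp c hp]
    have := rampTerm_sum_nonneg (c := c) (x := p.1) (y := p.2.1) (z := p.2.2)
      (by exact_mod_cast hp.1.1) (by exact_mod_cast hp.2.1.1) (by exact_mod_cast hp.2.2.1)
    have := wt3_pos k p
    positivity
  · have h1 : cyc p ∉ triples N := fun h => hp ⟨h.2.2, h.1, h.2.1⟩
    have h2 : cyc (cyc p) ∉ triples N := fun h => hp ⟨h.2.1, h.2.2, h.1⟩
    simp [cycSum, coef, Set.indicator_of_notMem hp, Set.indicator_of_notMem h1,
      Set.indicator_of_notMem h2]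

lemma pair_ramp_Q_nonneg (hk : 1 ≤ k) (c : ℝ) {x : L1} (hx : ∀ q, 0 ≤ x q) :
    0 ≤ pair k (rampQ c) (Q k N x) := by
  rw [pair_Q (tame_rampQ hk c)]
  exact cubic_nonneg_of_cycSum (norm_coef_br_le (tame_rampQ hk c)) hx (cycSum_ramp_nonneg c)

/-- The mass of the atom at `q`. -/
def atom (k : ℕ) (q : ℚ) (x : L1) : ℝ := pair k (spike q) x

lemma atom_nonneg {x : L1} (hx : ∀ q, 0 ≤ x q) (q : ℚ) : 0 ≤ atom k q x :=
  pair_nonneg hx (spike_nonneg q)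

lemma apply_eq_atom (x : L1) (q : ℚ) : x q = wt k q * atom k q x := apply_eq_pair_spike x q

/-- The lowest atom grows through its interaction with any other atom. -/
lemma atom_growth (hk : 1 ≤ k) {x : L1} (hx : ∀ q, 0 ≤ x q) {z : ℚ} (hz : z ∈ grid N)
    (hz2 : z ≠ mesh N) :
    atom k z x ^ 2 * atom k (mesh N) x * (mesh N / z)
      ≤ 3 * pair k (rampQ (2 * mesh N)) (Q k N x) := by
  have hT := tame_rampQ hk (2 * mesh N)
  have h := term_le_cubic (norm_coef_br_le (N := N) hT) hx (cycSum_ramp_nonneg _) (z, z, mesh N)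
  rw [pair_Q hT]
  refine (le_of_eq ?_).trans h
  have hm := mesh_cast_pos N
  have hz' : (0 : ℝ) < z := by exact_mod_cast hz.1
  have h2z : (2 * mesh N : ℝ) ≤ z := by exact_mod_cast two_mesh_le_of_ne hz hz2
  rw [cycSum_ramp _ (show (z, z, mesh N) ∈ triples N from ⟨hz, hz, mesh_mem_grid N⟩)]
  simp only [rampTerm]
  rw [PhiKer_eq_sqrt_right hm (by linarith) (by linarith), ramp_of_le h2z,
    ramp_of_le (q := (z : ℝ) + z - mesh N) (by linarith), ramp_of_ge (q := mesh N) (by linarith),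
    apply_eq_atom (k := k) x z, apply_eq_atom (k := k) x (mesh N), Real.sqrt_mul (by positivity),
    Real.sqrt_mul_self hz'.le, show (z : ℝ) + mesh N - z = mesh N by ring,
    show (mesh N : ℝ) + z - z = mesh N by ring, ramp_of_ge (q := mesh N) (by linarith), wt3]
  have s := Real.sqrt_pos.2 hm
  have w1 := wt_pos k z
  have w2 := wt_pos k (mesh N)
  field_simp
  ring

lemma pair_const_mul (c : ℝ) (φ : ℚ → ℝ) (x : L1) :
    pair k (fun q => c * φ q) x = c * pair k φ x := by
  unfold pair
  rw [← tsum_mul_left]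
  congr 1 with q
  ring

lemma pair_fun_add {φ ψ : ℚ → ℝ} (hφ : Tame k φ) (hψ : Tame k ψ) (x : L1) :
    pair k (fun q => φ q + ψ q) x = pair k φ x + pair k ψ x := by
  unfold pair
  rw [← (summable_pair hφ x).tsum_add (summable_pair hψ x)]
  congr 1 with q
  ring

lemma pair_ramp_two_mesh {x : L1} (hx : Supp N x) :
    pair k (rampQ (2 * mesh N)) x = mesh N * atom k (mesh N) x := by
  rw [atom, ← pair_const_mul]
  refine pair_congr fun q hq => ?_
  have hm := mesh_cast_pos N
  have hq := hx.mem hq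
  rw [rampQ, spike]
  split_ifs with h
  · rw [h, ramp_of_ge (by linarith)]; ring
  · have : (2 * mesh N : ℝ) ≤ q := by exact_mod_cast two_mesh_le_of_ne hq h
    rw [ramp_of_le this, mul_zero]

lemma pair_ramp_three_mesh {x : L1} (hx : Supp N x) :
    pair k (rampQ (3 * mesh N)) x = mesh N * (2 * atom k (mesh N) x + atom k (2 * mesh N) x) := by
  have hb : ∀ r : ℚ, Tame k fun q => 2 * spike r q := fun r =>
    tame_of_bounded (C := 2) fun q => by
      rw [abs_mul, abs_two]; linarith [abs_spike_le r q]
  rw [atom, atom, ← pair_const_mul, ← pair_fun_add (hb _) (tame_spike _), ← pair_const_mul]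
  refine pair_congr fun q hq => ?_
  have hm := mesh_cast_pos N
  have hm' := mesh_pos N
  have hq := hx.mem hq
  rw [rampQ, spike, spike]
  rcases grid_cases hq with h | h | h
  · rw [if_pos h, if_neg (by rw [h]; linarith), h, ramp_of_ge (by linarith)]; ring
  · rw [if_neg (by rw [h]; linarith), if_pos h, h, ramp_of_ge (by push_cast; linarith)]
    push_cast; ring
  · have : (3 * mesh N : ℝ) ≤ q := by exact_mod_cast h
    rw [if_neg (by linarith), if_neg (by linarith), ramp_of_le this]; ring


/-! ### Elementary facts about one-sided derivatives on an interval -/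

section Interval

variable {E : Type*} [NormedAddCommGroup E] [NormedSpace ℝ E] {a b : ℝ}

lemma continuousOn_of_hasDerivWithinAt {g g' : ℝ → E}
    (h : ∀ t ∈ Icc a b, HasDerivWithinAt g (g' t) (Icc a b) t) : ContinuousOn g (Icc a b) :=
  fun t ht => (h t ht).continuousWithinAt

lemma hasDerivWithinAt_Ici {g g' : ℝ → E}
    (h : ∀ t ∈ Icc a b, HasDerivWithinAt g (g' t) (Icc a b) t) :
    ∀ t ∈ Ico a b, HasDerivWithinAt g (g' t) (Ici t) t :=
  fun t ht => (h t ⟨ht.1, ht.2.le⟩).mono_of_mem_nhdsWithin (Icc_mem_nhdsGE_of_mem ht)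

lemma monotoneOn_of_hasDerivWithinAt {g g' : ℝ → ℝ}
    (h : ∀ t ∈ Icc a b, HasDerivWithinAt g (g' t) (Icc a b) t) (h0 : ∀ t ∈ Icc a b, 0 ≤ g' t) :
    MonotoneOn g (Icc a b) := by
  have hd : ∀ t ∈ interior (Icc a b), HasDerivAt g (g' t) t := fun t ht => by
    rw [interior_Icc] at ht
    exact (h t (Ioo_subset_Icc_self ht)).hasDerivAt (Icc_mem_nhds ht.1 ht.2)
  refine monotoneOn_of_deriv_nonneg (convex_Icc a b) (continuousOn_of_hasDerivWithinAt h)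
    (fun t ht => (hd t ht).differentiableAt.differentiableWithinAt) fun t ht => ?_
  rw [(hd t ht).deriv]
  exact h0 t (interior_subset ht)

lemma eq_of_hasDerivWithinAt_zero {g : ℝ → ℝ}
    (h : ∀ t ∈ Icc a b, HasDerivWithinAt g 0 (Icc a b) t) : ∀ t ∈ Icc a b, g t = g a :=
  constant_of_has_deriv_right_zero (continuousOn_of_hasDerivWithinAt h) (hasDerivWithinAt_Ici h)

lemma add_mul_le_of_hasDerivWithinAt {g g' : ℝ → ℝ} {c : ℝ} (hab : a ≤ b)
    (h : ∀ t ∈ Icc a b, HasDerivWithinAt g (g' t) (Icc a b) t) (hc : ∀ t ∈ Icc a b, c ≤ g' t) :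
    g a + c * (b - a) ≤ g b := by
  have := monotoneOn_of_hasDerivWithinAt (g := fun t => g t - c * t) (g' := fun t => g' t - c)
    (fun t ht => (h t ht).sub (by simpa using (hasDerivWithinAt_id t _).const_mul c))
    (fun t ht => by linarith [hc t ht]) (left_mem_Icc.2 hab) (right_mem_Icc.2 hab) hab
  simp only at this
  linarith

lemma nonneg_of_deriv_nonneg_of_neg {u u' : ℝ → ℝ}
    (h : ∀ t ∈ Icc a b, HasDerivWithinAt u (u' t) (Icc a b) t) (h0 : 0 ≤ u a)
    (hu : ∀ t ∈ Icc a b, u t < 0 → 0 ≤ u' t) : ∀ t ∈ Icc a b, 0 ≤ u t := by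
  intro t ht
  have key : ∀ ε > 0, -u t ≤ ε * (1 + (t - a)) := fun ε hε => by
    refine image_le_of_deriv_right_lt_deriv_boundary' (f := fun s => -u s) (f' := fun s => -u' s)
      (B := fun s => ε * (1 + (s - a))) (B' := fun _ => ε)
      (continuousOn_of_hasDerivWithinAt h).neg (fun s hs => (hasDerivWithinAt_Ici h s hs).neg)
      ?_ (by fun_prop) (fun s _ => ?_) (fun s hs he => ?_) ht
    · simp only [sub_self, add_zero, mul_one]; linarith
    · simpa using (((hasDerivWithinAt_id s (Ici s)).sub_const a).const_add 1).const_mul ε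
    · have h1 : 0 ≤ s - a := by linarith [hs.1]
      have : u s < 0 := by nlinarith
      linarith [hu s ⟨hs.1, hs.2.le⟩ this]
  by_contra! hlt
  have h1 : 0 ≤ t - a := by linarith [ht.1]
  have := key (-u t / (2 * (1 + (t - a)))) (div_pos (by linarith) (by positivity))
  have e : -u t / (2 * (1 + (t - a))) * (1 + (t - a)) = -u t / 2 := by field_simp
  rw [e] at this
  linarith

end Interval

/-! ### Positive part and radial truncation -/

/-- The coordinatewise positive part. -/
def posPart (x : L1) : L1 :=
  ⟨fun q => max (x q) 0, memℓp_gen (by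
    simp only [ENNReal.toReal_one, Real.rpow_one]
    refine Summable.of_nonneg_of_le (fun _ => norm_nonneg _) (fun q => ?_) (summable_abs x)
    rw [Real.norm_eq_abs, abs_of_nonneg (le_max_right _ _)]
    exact max_le (le_abs_self _) (abs_nonneg _))⟩

lemma posPart_apply (x : L1) (q : ℚ) : posPart x q = max (x q) 0 := rfl

lemma norm_posPart_sub_le (x y : L1) : ‖posPart x - posPart y‖ ≤ ‖x - y‖ :=
  hasSum_le (fun q => by
    simpa [posPart_apply] using abs_max_sub_max_le_abs (x q) (y q) 0) (hasSum_abs _) (hasSum_abs _)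

lemma posPart_of_nonneg {x : L1} (hx : ∀ q, 0 ≤ x q) : posPart x = x :=
  lp.ext (funext fun q => max_eq_left (hx q))

/-- The factor of the radial retraction onto the ball of radius `R`. -/
def radial (R : ℝ) (x : L1) : ℝ := R / max R ‖x‖

lemma radial_nonneg {R : ℝ} (hR : 0 < R) (x : L1) : 0 ≤ radial R x := by
  have : 0 < max R ‖x‖ := lt_max_of_lt_left hR
  unfold radial; positivity

lemma radial_le_one {R : ℝ} (hR : 0 < R) (x : L1) : radial R x ≤ 1 :=
  (div_le_one (lt_max_of_lt_left hR)).2 (le_max_left _ _)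

lemma radial_eq_one {R : ℝ} (hR : 0 < R) {x : L1} (hx : ‖x‖ ≤ R) : radial R x = 1 := by
  rw [radial, max_eq_left hx, div_self hR.ne']

lemma norm_radial_smul_le {R : ℝ} (hR : 0 < R) (x : L1) : ‖radial R x • x‖ ≤ R := by
  have h : 0 < max R ‖x‖ := lt_max_of_lt_left hR
  rw [norm_smul, Real.norm_eq_abs, abs_of_nonneg (radial_nonneg hR x), radial, div_mul_eq_mul_div,
    div_le_iff₀ h]
  gcongr
  exact le_max_right _ _

lemma norm_radial_smul_sub_le {R : ℝ} (hR : 0 < R) (x y : L1) :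
    ‖radial R x • x - radial R y • y‖ ≤ 2 * ‖x - y‖ := by
  have hx : 0 < max R ‖x‖ := lt_max_of_lt_left hR
  have hy : 0 < max R ‖y‖ := lt_max_of_lt_left hR
  have e : radial R x • x - radial R y • y = radial R x • (x - y) + (radial R x - radial R y) • y := by
    rw [smul_sub, sub_smul]; abel
  have h1 : ‖radial R x • (x - y)‖ ≤ ‖x - y‖ := by
    rw [norm_smul, Real.norm_eq_abs, abs_of_nonneg (radial_nonneg hR x)]
    exact mul_le_of_le_one_left (norm_nonneg _) (radial_le_one hR x)
  have h2 : ‖(radial R x - radial R y) • y‖ ≤ ‖x - y‖ := by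
    have e2 : radial R x - radial R y
        = (max ‖y‖ R - max ‖x‖ R) * (radial R x / max R ‖y‖) := by
      rw [max_comm ‖y‖, max_comm ‖x‖]; unfold radial; field_simp
    have h3 : |max ‖y‖ R - max ‖x‖ R| ≤ ‖x - y‖ := by
      refine (abs_max_sub_max_le_abs _ _ _).trans ?_
      rw [norm_sub_rev]; exact abs_norm_sub_norm_le y x
    have h4 : ‖y‖ / max R ‖y‖ ≤ 1 := (div_le_one hy).2 (le_max_right _ _)
    have h5 := radial_le_one hR x
    have h6 := radial_nonneg hR x
    rw [norm_smul, e2, Real.norm_eq_abs, abs_mul, abs_of_nonneg (div_nonneg h6 hy.le), mul_assoc,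
      div_mul_eq_mul_div, ← mul_div_assoc']
    refine (mul_le_of_le_one_right (abs_nonneg _) ?_).trans h3
    exact mul_le_one₀ h5 (by positivity) h4
  rw [e]
  linarith [norm_add_le (radial R x • (x - y)) ((radial R x - radial R y) • y)]

/-! ### Solutions of the truncated equation -/

lemma norm_Q_sub_le {R : ℝ} {x y : L1} (hx : ‖x‖ ≤ R) (hy : ‖y‖ ≤ R) :
    ‖Q k N x - Q k N y‖ ≤ 3 * growth k N * R ^ 2 * ‖x - y‖ :=
  norm_cubic_sub_le growth_pos.le norm_vec_le hx hy

/-- `f` solves the equation on the grid of level `N` up to time `T`. -/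
structure Sol (k N : ℕ) (T : ℝ) (f : ℝ → L1) : Prop where
  deriv : ∀ t ∈ Icc 0 T, HasDerivWithinAt f (Q k N (f t)) (Icc 0 T) t
  nonneg : ∀ t ∈ Icc 0 T, ∀ q, 0 ≤ f t q
  supp : ∀ t ∈ Icc 0 T, Supp N (f t)

lemma pair_hasDerivWithinAt {φ : ℚ → ℝ} (h : Tame k φ) {f : ℝ → L1} {f' : L1} {s : Set ℝ} {t : ℝ}
    (hf : HasDerivWithinAt f f' s t) :
    HasDerivWithinAt (fun t => pair k φ (f t)) (pair k φ f') s t :=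
  (pairL φ h).hasFDerivAt.comp_hasDerivWithinAt t hf

lemma apply_hasDerivWithinAt {f : ℝ → L1} {f' : L1} {s : Set ℝ} {t : ℝ}
    (hf : HasDerivWithinAt f f' s t) (r : ℚ) :
    HasDerivWithinAt (fun t => f t r) (f' r) s t := by
  simp_rw [fun x : L1 => apply_eq_pair_spike (k := 0) x r]
  exact (pair_hasDerivWithinAt (tame_spike r) hf).const_mul _

/-- The mass encoded by a state. -/
def mass (k : ℕ) (x : L1) : ℝ := pair k (fun _ => 1) x

lemma mass_nonneg {x : L1} (hx : ∀ q, 0 ≤ x q) : 0 ≤ mass k x :=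
  pair_nonneg hx fun _ => zero_le_one

lemma mass_eq_of_deriv {T : ℝ} {f : ℝ → L1} {c : ℝ → ℝ}
    (hd : ∀ t ∈ Icc 0 T, HasDerivWithinAt f (c t • Q k N (f t)) (Icc 0 T) t) :
    ∀ t ∈ Icc 0 T, mass k (f t) = mass k (f 0) :=
  eq_of_hasDerivWithinAt_zero fun t ht => by
    have := pair_hasDerivWithinAt (k := k) tame_one (hd t ht)
    rwa [pair_smul _ tame_one, pair_one_Q, mul_zero] at this

lemma norm_le_of_deriv {T : ℝ} {f : ℝ → L1} {c : ℝ → ℝ} (hc0 : ∀ t, 0 ≤ c t) (hc1 : ∀ t, c t ≤ 1)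
    (hd : ∀ t ∈ Icc 0 T, HasDerivWithinAt f (c t • Q k N (f t)) (Icc 0 T) t)
    (hf : ∀ t ∈ Icc 0 T, ∀ q, 0 ≤ f t q) :
    ∀ t ∈ Icc 0 T, ‖f t‖ ≤ (‖f 0‖ + 1) * exp ((growth k N * mass k (f 0) ^ 2 + 1) * t) := by
  intro t ht
  set K := growth k N * mass k (f 0) ^ 2
  have hK : 0 ≤ K := mul_nonneg growth_pos.le (sq_nonneg _)
  rw [← pair_wt_eq_norm (k := k) (hf t ht)]
  have hd' := fun t ht => pair_hasDerivWithinAt (φ := wt k) tame_wt (hd t ht)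
  refine image_le_of_deriv_right_lt_deriv_boundary' (continuousOn_of_hasDerivWithinAt hd')
    (hasDerivWithinAt_Ici hd') (B := fun t => (‖f 0‖ + 1) * exp ((K + 1) * t))
    (B' := fun t => (‖f 0‖ + 1) * (exp ((K + 1) * t) * (K + 1))) ?_ (by fun_prop)
    (fun s _ => ?_) (fun s hs he => ?_) ht
  · rw [pair_wt_eq_norm (hf 0 (left_mem_Icc.2 (ht.1.trans ht.2)))]
    simp
  · have := ((hasDerivWithinAt_id s (Ici s)).const_mul (K + 1)).exp.const_mul (‖f 0‖ + 1)
    simpa using this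
  · have hs' : s ∈ Icc 0 T := ⟨hs.1, hs.2.le⟩
    have h1 := pair_wt_Q_le (k := k) (N := N) (hf s hs')
    have h2 := mass_eq_of_deriv hd s hs'
    unfold mass at h2
    rw [h2, ← pair_wt_eq_norm (k := k) (hf s hs'), he] at h1
    rw [pair_smul _ tame_wt]
    have hB : 0 < (‖f 0‖ + 1) * exp ((K + 1) * s) := by positivity
    have h3 : c s * pair k (wt k) (Q k N (f s)) ≤ K * ((‖f 0‖ + 1) * exp ((K + 1) * s)) := by
      rcases le_total 0 (pair k (wt k) (Q k N (f s))) with h | h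
      · exact (mul_le_of_le_one_left h (hc1 s)).trans h1
      · exact (mul_nonpos_of_nonneg_of_nonpos (hc0 s) h).trans (mul_nonneg hK hB.le)
    nlinarith

lemma supp_of_deriv {T : ℝ} {f : ℝ → L1} {c : ℝ → ℝ} {y : ℝ → L1}
    (hd : ∀ t ∈ Icc 0 T, HasDerivWithinAt f (c t • Q k N (y t)) (Icc 0 T) t) (h0 : Supp N (f 0)) :
    ∀ t ∈ Icc 0 T, Supp N (f t) := fun t ht r hr => by
  rw [← h0 r hr]
  refine eq_of_hasDerivWithinAt_zero (g := fun t => f t r) (fun s hs => ?_) t ht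
  have := apply_hasDerivWithinAt (hd s hs) r
  rwa [lp.coeFn_smul, Pi.smul_apply, Q_apply_eq_zero hr, smul_zero] at this

theorem exists_sol (k : ℕ) {T : ℝ} (hT : 0 ≤ T) {x₀ : L1} (hx : ∀ q, 0 ≤ x₀ q) (hs : Supp N x₀) :
    ∃ f, f 0 = x₀ ∧ Sol k N T f := by
  set K := growth k N * mass k x₀ ^ 2
  have hK : 0 ≤ K := mul_nonneg growth_pos.le (sq_nonneg _)
  obtain ⟨R, hR⟩ : ∃ R, R = (‖x₀‖ + 1) * exp ((K + 1) * T) := ⟨_, rfl⟩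
  have hR0 : 0 < R := by rw [hR]; positivity
  have hg := growth_pos (k := k) (N := N)
  set F : L1 → L1 := fun x => Q k N (radial R (posPart x) • posPart x)
  have hF : ∀ x, ‖F x‖ ≤ growth k N * R ^ 3 := fun x => by
    refine (norm_cubic_le norm_vec_le _).trans ?_
    gcongr
    exact norm_radial_smul_le hR0 _
  have hFL : ∀ x y, ‖F x - F y‖ ≤ 3 * growth k N * R ^ 2 * 2 * ‖x - y‖ := fun x y => by
    refine (norm_Q_sub_le (norm_radial_smul_le hR0 _) (norm_radial_smul_le hR0 _)).trans ?_
    rw [mul_assoc _ 2]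
    gcongr
    refine (norm_radial_smul_sub_le hR0 _ _).trans ?_
    gcongr
    exact norm_posPart_sub_le x y
  have hP : IsPicardLindelof (fun _ => F) (⟨0, left_mem_Icc.2 hT⟩ : Icc 0 T) x₀
      (⟨growth k N * R ^ 3 * T, by positivity⟩ : ℝ≥0) 0
      (⟨growth k N * R ^ 3, by positivity⟩ : ℝ≥0)
      (⟨3 * growth k N * R ^ 2 * 2, by positivity⟩ : ℝ≥0) := by
    refine IsPicardLindelof.of_time_independent (fun x _ => hF x) ?_ ?_
    · exact LipschitzOnWith.of_dist_le_mul fun x _ y _ => by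
        rw [dist_eq_norm, dist_eq_norm]; exact hFL x y
    · simp only [NNReal.coe_zero, sub_zero, sub_self, max_eq_left hT]
      exact le_rfl
  obtain ⟨f, hf0, hfd⟩ := hP.exists_eq_forall_mem_Icc_hasDerivWithinAt₀
  have hf0 : f 0 = x₀ := hf0
  have hpos : ∀ t ∈ Icc 0 T, ∀ q, 0 ≤ f t q := fun t ht q => by
    refine nonneg_of_deriv_nonneg_of_neg (u := fun t => f t q)
      (fun s hs => apply_hasDerivWithinAt (hfd s hs) q) (by simpa [hf0] using hx q) (fun s _ hneg => ?_) t ht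
    have hz : posPart (f s) q = 0 := max_eq_right hneg.le
    exact Q_apply_nonneg (fun q => mul_nonneg (radial_nonneg hR0 _) (le_max_right _ _))
      (by rw [lp.coeFn_smul, Pi.smul_apply, hz, smul_zero])
  have hd : ∀ t ∈ Icc 0 T,
      HasDerivWithinAt f ((radial R (f t)) ^ 3 • Q k N (f t)) (Icc 0 T) t := fun t ht => by
    have := hfd t ht
    simp only [F] at this
    rwa [posPart_of_nonneg (hpos t ht), Q, cubic_smul_arg] at this
  have hn := norm_le_of_deriv (c := fun t => radial R (f t) ^ 3)
    (fun t => pow_nonneg (radial_nonneg hR0 _) 3)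
    (fun t => pow_le_one₀ (radial_nonneg hR0 _) (radial_le_one hR0 _)) hd hpos
  rw [hf0] at hn
  have hnR : ∀ t ∈ Icc 0 T, ‖f t‖ ≤ R := fun t ht => by
    refine (hn t ht).trans ?_
    rw [hR]
    gcongr
    exact ht.2
  refine ⟨f, hf0, fun t ht => ?_, hpos, supp_of_deriv hd (hf0 ▸ hs)⟩
  have := hd t ht
  rwa [radial_eq_one hR0 (hnR t ht), one_pow, one_smul] at this

namespace Sol

variable {T : ℝ} {f g : ℝ → L1}

lemma mono (h : Sol k N T f) {S : ℝ} (hS : S ≤ T) : Sol k N S f where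
  deriv t ht := (h.deriv t ⟨ht.1, ht.2.trans hS⟩).mono (Icc_subset_Icc_right hS)
  nonneg t ht := h.nonneg t ⟨ht.1, ht.2.trans hS⟩
  supp t ht := h.supp t ⟨ht.1, ht.2.trans hS⟩

lemma succ (h : Sol k N T f) : Sol k (N + 1) T f where
  deriv t ht := by rw [Q_succ (h.supp t ht)]; exact h.deriv t ht
  nonneg := h.nonneg
  supp t ht := (h.supp t ht).succ

lemma continuousOn (h : Sol k N T f) : ContinuousOn f (Icc 0 T) :=
  continuousOn_of_hasDerivWithinAt h.deriv

lemma pair_deriv (h : Sol k N T f) {φ : ℚ → ℝ} (hφ : Tame k φ) {t : ℝ} (ht : t ∈ Icc 0 T) :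
    HasDerivWithinAt (fun t => pair k φ (f t)) (pair k φ (Q k N (f t))) (Icc 0 T) t :=
  pair_hasDerivWithinAt hφ (h.deriv t ht)

lemma mass_eq (h : Sol k N T f) {t : ℝ} (ht : t ∈ Icc 0 T) : mass k (f t) = mass k (f 0) :=
  mass_eq_of_deriv (c := fun _ => 1) (fun t ht => by rw [one_smul]; exact h.deriv t ht) t ht

lemma energy_eq (h : Sol k N T f) (hk : 1 ≤ k) {t : ℝ} (ht : t ∈ Icc 0 T) :
    pair k (fun q => (q : ℝ)) (f t) = pair k (fun q => (q : ℝ)) (f 0) :=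
  eq_of_hasDerivWithinAt_zero (g := fun t => pair k (fun q => (q : ℝ)) (f t))
    (fun t ht => by have := h.pair_deriv (tame_id hk) ht; rwa [pair_id_Q hk] at this) t ht

lemma pair_ramp_monotoneOn (h : Sol k N T f) (hk : 1 ≤ k) (c : ℝ) :
    MonotoneOn (fun t => pair k (rampQ c) (f t)) (Icc 0 T) :=
  monotoneOn_of_hasDerivWithinAt (fun _ ht => h.pair_deriv (tame_rampQ hk c) ht)
    fun t ht => pair_ramp_Q_nonneg hk c (h.nonneg t ht)

lemma norm_le (h : Sol k N T f) {t : ℝ} (ht : t ∈ Icc 0 T) :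
    ‖f t‖ ≤ (‖f 0‖ + 1) * exp ((growth k N * mass k (f 0) ^ 2 + 1) * T) := by
  refine (norm_le_of_deriv (c := fun _ => 1) (fun _ => zero_le_one) (fun _ => le_rfl)
    (fun t ht => by rw [one_smul]; exact h.deriv t ht) h.nonneg t ht).trans ?_
  have := growth_pos (k := k) (N := N)
  gcongr
  exact ht.2

lemma norm_sub_le (hf : Sol k N T f) (hg : Sol k N T g) {R : ℝ}
    (hfR : ∀ t ∈ Icc 0 T, ‖f t‖ ≤ R) (hgR : ∀ t ∈ Icc 0 T, ‖g t‖ ≤ R) {t : ℝ} (ht : t ∈ Icc 0 T) :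
    ‖f t - g t‖ ≤ ‖f 0 - g 0‖ * exp (3 * growth k N * R ^ 2 * T) := by
  have hgr := growth_pos (k := k) (N := N)
  have := dist_le_of_trajectories_ODE_of_mem (v := fun _ => Q k N)
    (s := fun _ => Metric.closedBall 0 R) (K := ⟨3 * growth k N * R ^ 2, by positivity⟩)
    (δ := ‖f 0 - g 0‖)
    (fun t _ => LipschitzOnWith.of_dist_le_mul fun x hx y hy => by
      rw [dist_eq_norm, dist_eq_norm]
      exact norm_Q_sub_le (mem_closedBall_zero_iff.1 hx) (mem_closedBall_zero_iff.1 hy))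
    hf.continuousOn (hasDerivWithinAt_Ici hf.deriv)
    (fun t ht => mem_closedBall_zero_iff.2 (hfR t ⟨ht.1, ht.2.le⟩))
    hg.continuousOn (hasDerivWithinAt_Ici hg.deriv)
    (fun t ht => mem_closedBall_zero_iff.2 (hgR t ⟨ht.1, ht.2.le⟩)) (dist_eq_norm _ _).le t ht
  rw [dist_eq_norm, sub_zero] at this
  refine this.trans (mul_le_mul_of_nonneg_left (exp_le_exp.2 ?_) (norm_nonneg _))
  exact mul_le_mul_of_nonneg_left ht.2 (by positivity : 0 ≤ 3 * growth k N * R ^ 2)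

lemma eq_of_eq_zero (hf : Sol k N T f) (hg : Sol k N T g) (h0 : f 0 = g 0) {t : ℝ}
    (ht : t ∈ Icc 0 T) : f t = g t := by
  have := hf.norm_sub_le hg (fun t ht => (hf.norm_le ht).trans (le_max_left _ _))
    (fun t ht => (hg.norm_le ht).trans (le_max_right _ _)) ht
  rw [h0, sub_self, norm_zero, zero_mul] at this
  exact sub_eq_zero.1 (norm_le_zero_iff.1 this)

end Sol


/-! ### Concentration at the lowest grid point -/

/-- The energy encoded by a state. -/
def energy (k : ℕ) (x : L1) : ℝ := pair k (fun q => (q : ℝ)) x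

lemma atom_le_mass {x : L1} (hx : ∀ q, 0 ≤ x q) (q : ℚ) : atom k q x ≤ mass k x :=
  pair_mono (tame_spike q) tame_one hx fun r _ => spike_le_one q r

lemma abs_atom_le (q : ℚ) (x : L1) : |atom k q x| ≤ ‖x‖ := by
  have := abs_pair_le (k := k) (φ := spike q) (C := 1)
    (fun r => by rw [one_mul]; exact (abs_spike_le q r).trans (one_le_wt k r)) x
  rwa [one_mul] at this

lemma atom_sub (q : ℚ) (x y : L1) : atom k q (x - y) = atom k q x - atom k q y :=
  pair_sub _ (tame_spike q) x y

lemma atom_eq_zero_of_notMem {x : L1} (hx : Supp N x) {q : ℚ} (hq : q ∉ grid N) :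
    atom k q x = 0 := by
  rw [atom, pair_spike, hx q hq, zero_div]

lemma tame_sum {ι : Type*} (s : Finset ι) {φ : ι → ℚ → ℝ} (h : ∀ i, Tame k (φ i)) :
    Tame k fun q => ∑ i ∈ s, φ i q := by
  choose C hC using h
  refine ⟨∑ i ∈ s, C i, fun q => ?_⟩
  rw [Finset.sum_mul]
  exact (Finset.abs_sum_le_sum_abs _ _).trans (Finset.sum_le_sum fun i _ => hC i q)

lemma pair_sum {ι : Type*} (s : Finset ι) {φ : ι → ℚ → ℝ} (h : ∀ i, Tame k (φ i)) (x : L1) :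
    pair k (fun q => ∑ i ∈ s, φ i q) x = ∑ i ∈ s, pair k (φ i) x := by
  unfold pair
  rw [← Summable.tsum_finsetSum fun i _ => summable_pair (h i) x]
  congr 1 with q
  rw [Finset.sum_div, Finset.mul_sum]

lemma tame_const_mul {φ : ℚ → ℝ} (h : Tame k φ) (c : ℝ) : Tame k fun q => c * φ q := by
  obtain ⟨C, hC⟩ := h
  refine ⟨|c| * C, fun q => ?_⟩
  rw [abs_mul, mul_assoc]
  exact mul_le_mul_of_nonneg_left (hC q) (abs_nonneg c)

lemma tame_add {φ ψ : ℚ → ℝ} (h : Tame k φ) (h' : Tame k ψ) : Tame k fun q => φ q + ψ q := by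
  obtain ⟨C, hC⟩ := h
  obtain ⟨D, hD⟩ := h'
  exact ⟨C + D, fun q => (abs_add_le _ _).trans (by rw [add_mul]; exact add_le_add (hC q) (hD q))⟩

/-- If some mass is not at the lowest grid point, then a definite amount sits at another grid point
of bounded frequency. -/
lemma exists_large_atom (hk : 1 ≤ k) (N : ℕ) {η : ℝ} (hη : 0 < η) :
    ∃ κ > 0, ∀ x : L1, (∀ q, 0 ≤ x q) → Supp N x → energy k x ≤ 2 →
      η ≤ mass k x - atom k (mesh N) x →
      ∃ z ∈ grid N, z ≠ mesh N ∧ κ ≤ atom k z x ^ 2 * (mesh N / z) := by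
  have hm := mesh_cast_pos N
  have hmq := mesh_pos N
  obtain ⟨n, hn⟩ := exists_nat_gt (4 / η / mesh N)
  have hn0 : (0 : ℝ) < n := lt_trans (by positivity) hn
  have hnR : 4 / η ≤ n * mesh N := ((div_lt_iff₀ hm).1 hn).le
  set z : ℕ → ℚ := fun i => (i + 2) * mesh N with hz
  have hzm : ∀ i, z i ∈ grid N := fun i =>
    ⟨mul_pos (by positivity) hmq, i + 2, by rw [hz]; push_cast; ring⟩
  have hzne : ∀ i, z i ≠ mesh N := fun i h => by
    have : (0 : ℚ) ≤ i := by positivity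
    have h' : ((i : ℚ) + 2) * mesh N = mesh N := h
    nlinarith
  have hzc : ∀ i, ((z i : ℚ) : ℝ) = (i + 2) * mesh N := fun i => by rw [hz]; push_cast; ring
  refine ⟨(η / (2 * n)) ^ 2 * (1 / (n + 2)), by positivity, fun x hx hs hE hle => ?_⟩
  have hsum : mass k x ≤ atom k (mesh N) x + (∑ i ∈ Finset.range n, atom k (z i) x
      + η / 4 * energy k x) := by
    unfold mass atom energy
    rw [← pair_sum _ fun i => tame_spike (z i), ← pair_const_mul,
      ← pair_fun_add (tame_sum _ fun i => tame_spike (z i)) (tame_const_mul (tame_id hk) _),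
      ← pair_fun_add (tame_spike _)
        (tame_add (tame_sum _ fun i => tame_spike (z i)) (tame_const_mul (tame_id hk) _))]
    refine pair_mono tame_one (tame_add (tame_spike _)
        (tame_add (tame_sum _ fun i => tame_spike (z i)) (tame_const_mul (tame_id hk) _))) hx
        fun q hq => ?_
    obtain ⟨hq0, j, hj⟩ := hs.mem hq
    have hq0' : (0 : ℝ) < q := by exact_mod_cast hq0
    have hj0 : 0 < (j : ℚ) := pos_of_mul_pos_left (hj ▸ hq0) hmq.le
    have hj1 : 0 < j := by exact_mod_cast hj0
    have hsn : 0 ≤ ∑ i ∈ Finset.range n, spike (z i) q :=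
      Finset.sum_nonneg fun i _ => spike_nonneg _ _
    have hen : 0 ≤ η / 4 * (q : ℝ) := by positivity
    have hsp := spike_nonneg (mesh N) q
    obtain rfl | h2 : j = 1 ∨ 2 ≤ j := by omega
    · have : spike (mesh N) q = 1 := if_pos (by rw [hj]; simp)
      linarith
    obtain ⟨i, rfl⟩ : ∃ i : ℕ, j = i + 2 := ⟨(j - 2).toNat, by omega⟩
    by_cases hi : i < n
    · have h1 : spike (z i) q = 1 := if_pos (by rw [hj, hz]; push_cast; ring)
      have h3 := Finset.single_le_sum (f := fun i => spike (z i) q)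
        (fun i _ => spike_nonneg _ _) (Finset.mem_range.2 hi)
      linarith
    · have hni : (n : ℝ) ≤ i := by exact_mod_cast not_lt.1 hi
      have hqe : (q : ℝ) = (i + 2) * mesh N := by rw [hj]; push_cast; ring
      have : 4 / η ≤ q := hnR.trans (by rw [hqe]; gcongr; linarith)
      have : η / 4 * (4 / η) ≤ η / 4 * q := by gcongr
      have e : η / 4 * (4 / η) = 1 := by field_simp
      linarith
  have hbig : ∑ i ∈ Finset.range n, η / (2 * n) ≤ ∑ i ∈ Finset.range n, atom k (z i) x := by
    have e : ∑ i ∈ Finset.range n, η / (2 * n) = η / 2 := by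
      rw [Finset.sum_const, Finset.card_range, nsmul_eq_mul]; field_simp
    rw [e]
    nlinarith
  obtain ⟨i, hi, hle⟩ := Finset.exists_le_of_sum_le
    (Finset.nonempty_range_iff.2 (by rintro rfl; simp at hn0)) hbig
  refine ⟨z i, hzm i, hzne i, ?_⟩
  have hin : (i : ℝ) ≤ n := by exact_mod_cast (Finset.mem_range.1 hi).le
  have e : (mesh N : ℝ) / z i = 1 / (i + 2) := by rw [hzc]; field_simp
  rw [e]
  gcongr

lemma Sol.atom_deriv {T : ℝ} {f : ℝ → L1} (h : Sol k N T f) {t : ℝ} (ht : t ∈ Icc 0 T) :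
    HasDerivWithinAt (fun t => atom k (mesh N) (f t)) (atom k (mesh N) (Q k N (f t))) (Icc 0 T) t :=
  h.pair_deriv (tame_spike _) ht

lemma supp_Q (x : L1) : Supp N (Q k N x) := fun _ hq => Q_apply_eq_zero hq x

lemma Sol.atom_monotoneOn {T : ℝ} {f : ℝ → L1} (h : Sol k N T f) (hk : 1 ≤ k) :
    MonotoneOn (fun t => atom k (mesh N) (f t)) (Icc 0 T) :=
  monotoneOn_of_hasDerivWithinAt (fun _ ht => h.atom_deriv ht) fun t ht => by
    have h1 := pair_ramp_Q_nonneg (N := N) hk (2 * mesh N) (h.nonneg t ht)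
    rw [pair_ramp_two_mesh (supp_Q _)] at h1
    exact nonneg_of_mul_nonneg_right h1 (mesh_cast_pos N)

/-- Once the lowest atom has mass at least `δ`, it absorbs all mass but `η` in a time depending only
on the level, `δ` and `η`. -/
lemma exists_absorption_time (hk : 1 ≤ k) (N : ℕ) {δ η : ℝ} (hδ : 0 < δ) (hη : 0 < η) :
    ∃ L : ℝ, 1 ≤ L ∧ ∀ (T : ℝ) (f : ℝ → L1), Sol k N T f → mass k (f 0) ≤ 2 → energy k (f 0) ≤ 2 →
      ∀ t₀, 0 ≤ t₀ → t₀ + L ≤ T → δ ≤ atom k (mesh N) (f t₀) →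
        mass k (f 0) - atom k (mesh N) (f (t₀ + L)) ≤ η := by
  obtain ⟨κ, hκ, H⟩ := exists_large_atom hk N hη
  have hm := mesh_cast_pos N
  set c : ℝ := κ * δ / (3 * mesh N)
  have hc : 0 < c := by positivity
  refine ⟨max 1 (2 / c), le_max_left _ _, fun T f hf hM hE t₀ ht₀ htL ha => ?_⟩
  set L : ℝ := max 1 (2 / c)
  have hL : 2 / c ≤ L := le_max_right _ _
  have hL1 : 1 ≤ L := le_max_left _ _
  by_contra! hlt
  have hmono := hf.atom_monotoneOn hk
  have hsub : Icc t₀ (t₀ + L) ⊆ Icc 0 T := Icc_subset_Icc ht₀ htL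
  have hend : t₀ + L ∈ Icc t₀ (t₀ + L) := ⟨by linarith, le_rfl⟩
  have hstart : t₀ ∈ Icc t₀ (t₀ + L) := ⟨le_rfl, by linarith⟩
  have key := add_mul_le_of_hasDerivWithinAt (c := c) (by linarith : t₀ ≤ t₀ + L)
    (fun t ht => (hf.atom_deriv (hsub ht)).mono hsub) fun t ht => by
      have ht' := hsub ht
      have h1 : atom k (mesh N) (f t) ≤ atom k (mesh N) (f (t₀ + L)) := hmono ht' (hsub hend) ht.2
      have h2 : δ ≤ atom k (mesh N) (f t) := ha.trans (hmono (hsub hstart) ht' ht.1)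
      obtain ⟨z, hz, hzne, hκz⟩ := H (f t) (hf.nonneg t ht') (hf.supp t ht')
        (by unfold energy at hE ⊢; rw [hf.energy_eq hk ht']; exact hE)
        (by rw [hf.mass_eq ht']; linarith)
      have h3 := atom_growth (N := N) hk (hf.nonneg t ht') hz hzne
      rw [pair_ramp_two_mesh (supp_Q _)] at h3
      have h4 : κ * δ ≤ atom k z (f t) ^ 2 * (mesh N / z) * atom k (mesh N) (f t) :=
        mul_le_mul hκz h2 hδ.le (hκ.le.trans hκz)
      rw [div_le_iff₀ (by positivity)]
      linarith
  have h5 := atom_le_mass (k := k) (hf.nonneg _ (hsub hend)) (mesh N)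
  rw [hf.mass_eq (hsub hend)] at h5
  have h6 : 2 ≤ c * L := by rw [div_le_iff₀ hc] at hL; linarith
  have e : t₀ + L - t₀ = L := by ring
  rw [e] at key
  linarith

/-! ### The inductive construction -/

/-- A solution of level `N` that at time `T` has nearly all its mass at the lowest grid point. -/
structure Stage (k N : ℕ) (f : ℝ → L1) (T : ℝ) : Prop where
  time_nonneg : 0 ≤ T
  sol : Sol k N T f
  one_le_mass : 1 ≤ mass k (f 0)
  mass_le : mass k (f 0) ≤ 2 - mesh N
  energy_le : energy k (f 0) ≤ 2 - mesh N
  concentrated : mass k (f 0) - atom k (mesh N) (f T) ≤ mesh N / 2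

/-- The relation between consecutive stages: `τ` is the time at which the mass starts to leave
the point `mesh N`, and `s` a time at which it is split evenly. -/
structure Link (k N : ℕ) (f : ℝ → L1) (T : ℝ) (f' : ℝ → L1) (T' τ s : ℝ) : Prop where
  close : ∀ t ∈ Icc 0 T, ‖f' t - f t‖ ≤ mesh N
  mass_le : mass k (f 0) ≤ mass k (f' 0)
  time_le : T + 1 ≤ T'
  long : (N + 1) * (T + (T' - τ)) ≤ τ
  le_tau : T ≤ τ
  tau_le : τ ≤ T'
  resting : ∀ t ∈ Icc T τ, mass k (f' 0) - atom k (mesh N) (f' t) ≤ mesh N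
  split_mem : s ∈ Icc τ T'
  split : atom k (mesh (N + 1)) (f' s) = mass k (f' 0) / 2

lemma mesh_cast_succ (N : ℕ) : (mesh (N + 1) : ℝ) = mesh N / 2 := by
  have h : ((2 * mesh (N + 1) : ℚ) : ℝ) = mesh N := by rw [two_mul_mesh_succ]
  push_cast at h
  linarith

lemma mesh_cast_le_one (N : ℕ) : (mesh N : ℝ) ≤ 1 := by
  rw [mesh_cast]
  exact inv_le_one_of_one_le₀ (one_le_pow₀ one_le_two)

/-- The state consisting of a unit mass at `q`. -/
def unitAtom (k : ℕ) (q : ℚ) : L1 := wt k q • unitVec q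

lemma pair_unitAtom {φ : ℚ → ℝ} (h : Tame k φ) (q : ℚ) : pair k φ (unitAtom k q) = φ q := by
  rw [unitAtom, pair_smul _ h, pair_unitVec]
  field_simp [(wt_pos k q).ne']

lemma unitAtom_nonneg (q r : ℚ) : 0 ≤ unitAtom k q r := by
  rw [unitAtom, lp.coeFn_smul, Pi.smul_apply, unitVec_apply, smul_eq_mul]
  exact mul_nonneg (wt_pos k q).le (by split_ifs <;> norm_num)

lemma supp_unitAtom : Supp N (unitAtom k (mesh N)) := fun q hq => by
  have : q ≠ mesh N := by rintro rfl; exact hq (mesh_mem_grid N)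
  rw [unitAtom, lp.coeFn_smul, Pi.smul_apply, unitVec_apply, if_neg this, smul_zero]

lemma norm_unitAtom (q : ℚ) : ‖unitAtom k q‖ = wt k q := by
  rw [unitAtom, norm_smul, norm_unitVec, mul_one, Real.norm_eq_abs, abs_of_pos (wt_pos k q)]

lemma exists_initial_stage (hk : 1 ≤ k) : ∃ f, Stage k 0 f 0 := by
  obtain ⟨f, h0, hf⟩ := exists_sol k (N := 0) le_rfl
    (x₀ := unitAtom k (mesh 0)) (unitAtom_nonneg _) supp_unitAtom
  have e : ((mesh 0 : ℚ) : ℝ) = 1 := by simp [mesh]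
  have hE : energy k (unitAtom k (mesh 0)) = 1 := by
    rw [energy, pair_unitAtom (tame_id hk), e]
  refine ⟨f, le_rfl, hf, ?_, ?_, ?_, ?_⟩ <;> rw [h0]
  · rw [mass, pair_unitAtom tame_one]
  · rw [mass, pair_unitAtom tame_one, e]; norm_num
  · rw [hE, e]; norm_num
  · rw [mass, atom, pair_unitAtom tame_one, pair_unitAtom (tame_spike _), e, spike, if_pos rfl]
    norm_num

/-- A small atom placed at the lowest point of the next grid leads to the next stage. -/
theorem Stage.exists_next (hk : 1 ≤ k) {f : ℝ → L1} {T : ℝ} (h : Stage k N f T) :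
    ∃ f' T' τ s, Stage k (N + 1) f' T' ∧ Link k N f T f' T' τ s := by
  have hm := mesh_cast_pos N
  have hm1 := mesh_cast_le_one N
  have hT := h.time_nonneg
  have h0 : (0 : ℝ) ∈ Icc 0 T := left_mem_Icc.2 hT
  obtain ⟨δ, hδ⟩ : ∃ δ : ℝ, δ = mesh N / 8 := ⟨_, rfl⟩
  have hδ0 : 0 < δ := by rw [hδ]; positivity
  obtain ⟨L, hL1, hL⟩ := exists_absorption_time hk (N + 1) hδ0 (η := mesh N / 4) (by positivity)
  obtain ⟨B, hB⟩ : ∃ B : ℝ, B = (N + 1) * (T + L) := ⟨_, rfl⟩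
  have hN0 : (0 : ℝ) ≤ N := by positivity
  have hBT : T ≤ B := by rw [hB]; nlinarith
  have hB0 : 0 ≤ B := hT.trans hBT
  obtain ⟨g, hg0, hg⟩ := exists_sol k hB0 (h.sol.nonneg 0 h0) (h.sol.supp 0 h0)
  have hgf : ∀ t ∈ Icc 0 T, g t = f t := fun t ht => (hg.mono hBT).eq_of_eq_zero h.sol hg0 ht
  set w := wt k (mesh (N + 1))
  have hw : 0 < w := wt_pos _ _
  obtain ⟨R, hR⟩ : ∃ R : ℝ,
    R = (‖f 0‖ + w + 1) * exp ((growth k (N + 1) * 3 ^ 2 + 1) * B) := ⟨_, rfl⟩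
  have hgr := growth_pos (k := k) (N := N + 1)
  obtain ⟨E, hE⟩ : ∃ E : ℝ, E = w * exp (3 * growth k (N + 1) * R ^ 2 * B) := ⟨_, rfl⟩
  have hE0 : 0 < E := by rw [hE]; positivity
  obtain ⟨ε, hε⟩ : ∃ ε : ℝ, ε = δ / (E + 1) := ⟨_, rfl⟩
  have hε0 : 0 < ε := by rw [hε]; positivity
  have hεE : ε * E + ε = δ := by rw [hε]; field_simp
  have hεE' : 0 < ε * E := mul_pos hε0 hE0
  set y : L1 := f 0 + ε • unitAtom k (mesh (N + 1)) with hy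
  have hy0 : ∀ q, 0 ≤ y q := fun q =>
    add_nonneg (h.sol.nonneg 0 h0 q) (mul_nonneg hε0.le (unitAtom_nonneg _ q))
  have hys : Supp (N + 1) y := fun q hq => by
    have e1 := (h.sol.supp 0 h0).succ q hq
    have e2 := supp_unitAtom (k := k) q hq
    rw [hy, lp.coeFn_add, Pi.add_apply, lp.coeFn_smul, Pi.smul_apply, e1, e2, smul_zero, add_zero]
  have hpy : ∀ φ : ℚ → ℝ, Tame k φ → pair k φ y = pair k φ (f 0) + ε * φ (mesh (N + 1)) :=
    fun φ hφ => by rw [hy, pair_add _ hφ, pair_smul _ hφ, pair_unitAtom hφ]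
  have hMy : mass k y = mass k (f 0) + ε := by rw [mass, hpy _ tame_one, mul_one, mass]
  have hEy : energy k y = energy k (f 0) + ε * (mesh N / 2) := by
    rw [energy, hpy _ (tame_id hk), energy, mesh_cast_succ]
  have hAy : ε = atom k (mesh (N + 1)) y := by
    have := atom_eq_zero_of_notMem (k := k) (h.sol.supp 0 h0) (mesh_succ_notMem N)
    unfold atom at this ⊢
    rw [hpy _ (tame_spike _), this, spike, if_pos rfl, zero_add, mul_one]
  have hM1 := h.one_le_mass
  have hM2 := h.mass_le
  have hE2 := h.energy_le
  have hMy2 : mass k y ≤ 2 := by rw [hMy]; linarith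
  have hEy2 : energy k y ≤ 2 := by rw [hEy]; nlinarith
  obtain ⟨L₂, hL₂1, hL₂⟩ := exists_absorption_time hk (N + 1) hε0 (η := 1 / 2) (by norm_num)
  obtain ⟨f', hf0, hf⟩ := exists_sol k (T := B + L₂ + L) (by linarith) hy0 hys
  have hH : (0 : ℝ) ∈ Icc 0 (B + L₂ + L) := ⟨le_rfl, by linarith⟩
  have hBf := hf.mono (show B ≤ B + L₂ + L by linarith)
  have hclose : ∀ t ∈ Icc 0 B, ‖f' t - g t‖ ≤ ε * E := fun t ht => by
    have h1 : ∀ t ∈ Icc 0 B, ‖f' t‖ ≤ R := fun t ht => by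
      refine (hBf.norm_le ht).trans ?_
      have e1 : ‖y‖ ≤ ‖f 0‖ + w := by
        refine (norm_add_le _ _).trans ?_
        rw [norm_smul, norm_unitAtom, Real.norm_eq_abs, abs_of_pos hε0]
        have : ε * w ≤ 1 * w := by gcongr; linarith
        linarith
      have e2 : 0 ≤ mass k y := mass_nonneg hy0
      rw [hf0, hR]
      gcongr
      linarith
    have h2 : ∀ t ∈ Icc 0 B, ‖g t‖ ≤ R := fun t ht => by
      refine (hg.succ.norm_le ht).trans ?_
      have e2 : 0 ≤ mass k (f 0) := by linarith
      rw [hg0, hR]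
      gcongr
      · linarith
      · linarith
    refine (hBf.norm_sub_le hg.succ h1 h2 ht).trans (le_of_eq ?_)
    rw [hf0, hg0, hy, add_sub_cancel_left, norm_smul, norm_unitAtom, Real.norm_eq_abs,
      abs_of_pos hε0, hE]
    ring
  have hsmall : ∀ t ∈ Icc 0 B, atom k (mesh (N + 1)) (f' t) < δ := fun t ht => by
    have e1 := abs_atom_le (k := k) (mesh (N + 1)) (f' t - g t)
    rw [atom_sub, atom_eq_zero_of_notMem (hg.supp t ht) (mesh_succ_notMem N), sub_zero] at e1
    linarith [le_abs_self (atom k (mesh (N + 1)) (f' t)), hclose t ht]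
  have hcont : ContinuousOn (fun t => atom k (mesh (N + 1)) (f' t)) (Icc 0 (B + L₂ + L)) :=
    continuousOn_of_hasDerivWithinAt fun t ht => hf.atom_deriv ht
  have hmono := hf.atom_monotoneOn hk
  have hreach := hL₂ _ f' hf (hf0 ▸ hMy2) (hf0 ▸ hEy2) 0 le_rfl (by linarith) (by rw [hf0, ← hAy])
  rw [zero_add, hf0] at hreach
  obtain ⟨τ, hτ, hτδ⟩ : ∃ τ ∈ Icc 0 L₂, atom k (mesh (N + 1)) (f' τ) = δ := by
    refine intermediate_value_Icc (by linarith)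
      (hcont.mono (Icc_subset_Icc_right (by linarith))) ⟨?_, ?_⟩
    · rw [hf0, ← hAy]; linarith
    · linarith
  have hBτ : B ≤ τ := by
    by_contra! hlt
    exact (hsmall τ ⟨hτ.1, hlt.le⟩).ne hτδ
  have hτH : τ ∈ Icc 0 (B + L₂ + L) := ⟨hτ.1, by linarith [hτ.2]⟩
  have hTL : τ + L ≤ B + L₂ + L := by linarith [hτ.2]
  have hconc := hL _ f' hf (hf0 ▸ hMy2) (hf0 ▸ hEy2) τ hτ.1 hTL hτδ.ge
  obtain ⟨s, hs, hsm⟩ : ∃ s ∈ Icc τ (τ + L), atom k (mesh (N + 1)) (f' s) = mass k y / 2 := by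
    refine intermediate_value_Icc (by linarith)
      (hcont.mono (Icc_subset_Icc hτ.1 hTL)) ⟨?_, ?_⟩
    · linarith
    · rw [hf0] at hconc; linarith
  refine ⟨f', τ + L, τ, s, ⟨by linarith, hf.mono hTL, ?_, ?_, ?_, ?_⟩,
    ⟨fun t ht => ?_, ?_, by linarith, ?_, by linarith, by linarith, fun t ht => ?_, hs, ?_⟩⟩
  · rw [hf0]; linarith
  · rw [hf0, mesh_cast_succ]; linarith
  · rw [hf0, mesh_cast_succ]; nlinarith
  · rw [mesh_cast_succ]; linarith
  · rw [← hgf t ht]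
    exact (hclose t ⟨ht.1, ht.2.trans hBT⟩).trans (by linarith)
  · rw [hf0]; linarith
  · rw [add_sub_cancel_left, ← hB]; exact hBτ
  · have htH : t ∈ Icc 0 (B + L₂ + L) := ⟨hT.trans ht.1, ht.2.trans hτH.2⟩
    have hTH : T ∈ Icc 0 (B + L₂ + L) := ⟨hT, ht.1.trans htH.2⟩
    have e1 := hf.pair_ramp_monotoneOn hk (3 * mesh (N + 1)) hTH htH ht.1
    simp only at e1
    rw [pair_ramp_three_mesh (hf.supp _ hTH), pair_ramp_three_mesh (hf.supp _ htH),
      two_mul_mesh_succ] at e1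
    have e2 := le_of_mul_le_mul_left e1 (mesh_cast_pos (N + 1))
    have e3 : atom k (mesh (N + 1)) (f' t) ≤ δ := hτδ ▸ hmono htH hτH ht.2
    have e4 := atom_nonneg (k := k) (hf.nonneg T hTH) (mesh (N + 1))
    have e5 := abs_atom_le (k := k) (mesh N) (f' T - g T)
    rw [atom_sub, hgf T ⟨hT, le_rfl⟩] at e5
    have e6 := neg_abs_le (atom k (mesh N) (f' T) - atom k (mesh N) (f T))
    have e7 := hclose T ⟨hT, hBT⟩
    rw [hgf T ⟨hT, le_rfl⟩] at e7
    have e8 := h.concentrated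
    rw [hf0]
    linarith
  · rw [hf0, hsm]


/-! ### The limit of the stages -/

/-- An infinite sequence of consecutive stages. -/
structure Cascade (k : ℕ) (f : ℕ → ℝ → L1) (T τ s : ℕ → ℝ) : Prop where
  stage : ∀ n, Stage k n (f n) (T n)
  link : ∀ n, Link k n (f n) (T n) (f (n + 1)) (T (n + 1)) (τ n) (s n)

theorem exists_cascade (hk : 1 ≤ k) : ∃ f T τ s, Cascade k f T τ s := by
  obtain ⟨f₀, h₀⟩ := exists_initial_stage hk
  let S (n : ℕ) := {p : (ℝ → L1) × ℝ // Stage k n p.1 p.2}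
  have hnext : ∀ (n : ℕ) (p : S n), ∃ (p' : S (n + 1)) (u : ℝ × ℝ),
      Link k n p.1.1 p.1.2 p'.1.1 p'.1.2 u.1 u.2 := fun n p => by
    obtain ⟨f', T', τ, s, h, hl⟩ := p.2.exists_next hk
    exact ⟨⟨(f', T'), h⟩, (τ, s), hl⟩
  choose next u hu using hnext
  let p (n : ℕ) : S n := Nat.rec ⟨(f₀, 0), h₀⟩ (fun n q => next n q) n
  exact ⟨fun n => (p n).1.1, fun n => (p n).1.2, fun n => (u n (p n)).1, fun n => (u n (p n)).2,
    fun n => (p n).2, fun n => hu n (p n)⟩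

namespace Cascade

variable {f : ℕ → ℝ → L1} {T τ s : ℕ → ℝ}

lemma le_time (h : Cascade k f T τ s) (n : ℕ) : (n : ℝ) ≤ T n := by
  induction n with
  | zero => simpa using (h.stage 0).time_nonneg
  | succ n ih => push_cast; linarith [(h.link n).time_le]

lemma time_monotone (h : Cascade k f T τ s) : Monotone T :=
  monotone_nat_of_le_succ fun n => by linarith [(h.link n).time_le]

lemma tendsto_time (h : Cascade k f T τ s) : Tendsto T atTop atTop :=
  tendsto_atTop_mono h.le_time tendsto_natCast_atTop_atTop

lemma dist_succ_le (h : Cascade k f T τ s) {n : ℕ} {t : ℝ} (ht : t ∈ Icc 0 (T n)) (j : ℕ) :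
    dist (f (n + j) t) (f (n + j + 1) t) ≤ 2 * mesh n / 2 / 2 ^ j := by
  rw [dist_comm, dist_eq_norm]
  refine ((h.link (n + j)).close t
    ⟨ht.1, ht.2.trans (h.time_monotone (Nat.le_add_right n j))⟩).trans (le_of_eq ?_)
  rw [mesh_cast, mesh_cast, pow_add]
  field_simp

lemma exists_limit (h : Cascade k f T τ s) : ∃ F : ℝ → L1, Continuous F ∧
    (∀ t q, 0 ≤ F t q) ∧ (∀ t, ∀ q ≤ 0, F t q = 0) ∧
    ∀ n, ∀ t ∈ Icc 0 (T n), ‖f n t - F t‖ ≤ 2 * mesh n := by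
  have hlim : ∀ t : ℝ, ∃ x, Tendsto (fun n => f n (max t 0)) atTop (𝓝 x) := fun t => by
    obtain ⟨n, hn⟩ := exists_nat_ge (max t 0)
    have ht : max t 0 ∈ Icc 0 (T n) := ⟨le_max_right _ _, hn.trans (h.le_time n)⟩
    obtain ⟨x, hx⟩ := cauchySeq_tendsto_of_complete
      (cauchySeq_of_le_geometric_two fun j => h.dist_succ_le ht j)
    refine ⟨x, (tendsto_add_atTop_iff_nat n).1 ?_⟩
    simpa only [add_comm n] using hx
  choose F hF using hlim
  have hev : ∀ t : ℝ, ∀ᶠ n in atTop, max t 0 ∈ Icc 0 (T n) := fun t =>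
    (h.tendsto_time.eventually_ge_atTop (max t 0)).mono fun n hn => ⟨le_max_right _ _, hn⟩
  have happ : ∀ (t : ℝ) (q : ℚ), Tendsto (fun n => f n (max t 0) q) atTop (𝓝 (F t q)) :=
    fun t q => by
      simp_rw [fun x : L1 => apply_eq_pair_spike (k := 0) x q]
      exact (((pairL (spike q) (tame_spike q)).continuous.tendsto _).comp (hF t)).const_mul _
  have hclose : ∀ n, ∀ t ∈ Icc 0 (T n), ‖f n t - F t‖ ≤ 2 * mesh n := fun n t ht => by
    have hx := (tendsto_add_atTop_iff_nat n).2 (hF t)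
    rw [max_eq_left ht.1] at hx
    simp only [add_comm _ n] at hx
    rw [← dist_eq_norm]
    exact dist_le_of_le_geometric_two_of_tendsto₀ (f := fun j => f (n + j) t)
      (fun j => h.dist_succ_le ht j) hx
  refine ⟨F, ?_, fun t q => ?_, fun t q hq => ?_, hclose⟩
  · have hFm : ∀ t, F t = F (max t 0) := fun t => by
      have := hF (max t 0)
      rw [max_eq_left (le_max_right t 0)] at this
      exact tendsto_nhds_unique (hF t) this
    have hon : ∀ M, 0 ≤ M → ContinuousOn F (Icc 0 M) := fun M hM => by
      refine continuousOn_of_uniform_approx_of_continuousOn fun u hu => ?_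
      obtain ⟨ε, hε, hεu⟩ := Metric.mem_uniformity_dist.1 hu
      have h2 : Tendsto (fun n : ℕ => 2 * (mesh n : ℝ)) atTop (𝓝 0) := by
        simp_rw [mesh_cast]
        simpa using (tendsto_inv_atTop_zero.comp
          (tendsto_pow_atTop_atTop_of_one_lt (one_lt_two (α := ℝ)))).const_mul 2
      obtain ⟨n, hn, hnT⟩ :=
        ((h2.eventually_lt_const hε).and (h.tendsto_time.eventually_ge_atTop M)).exists
      refine ⟨f n, (h.stage n).sol.continuousOn.mono (Icc_subset_Icc_right hnT), fun t ht => ?_⟩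
      refine hεu ?_
      rw [dist_comm, dist_eq_norm]
      exact (hclose n t ⟨ht.1, ht.2.trans hnT⟩).trans_lt hn
    have hIci : ContinuousOn F (Ici 0) := fun t ht => by
      refine ((hon (t + 1) (by linarith [mem_Ici.1 ht])) t
        ⟨ht, by linarith⟩).mono_of_mem_nhdsWithin ?_
      exact mem_of_superset (inter_mem_nhdsWithin _ (Iic_mem_nhds (by linarith : t < t + 1)))
        fun x hx => hx
    have := hIci.comp_continuous (continuous_id.max continuous_const) fun t => le_max_right t 0
    exact this.congr fun t => (hFm t).symm
  · refine ge_of_tendsto (happ t q) ((hev t).mono fun n hn => ?_)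
    exact (h.stage n).sol.nonneg _ hn q
  · refine tendsto_nhds_unique (happ t q) (tendsto_const_nhds.congr' ((hev t).mono fun n hn => ?_))
    exact ((h.stage n).sol.supp _ hn q fun hg => (pos_of_mem_grid hg).not_ge hq).symm

end Cascade

/-! ### The measure encoded by a state -/

/-- The measure with mass `x q / wt k q` at `q`. -/
def toMeasure (k : ℕ) (x : L1) : Measure ℝ :=
  Measure.sum fun q : ℚ => ENNReal.ofReal (x q / wt k q) • Measure.dirac (q : ℝ)

lemma integral_toMeasure {x : L1} (hx : ∀ q, 0 ≤ x q) (φ : ℝ → ℝ) :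
    ∫ ω, φ ω ∂toMeasure k x = pair k (fun q => φ q) x := by
  rw [toMeasure, integral_sum_dirac fun _ => ENNReal.ofReal_ne_top]
  unfold pair
  congr 1 with q
  rw [ENNReal.toReal_ofReal (div_nonneg (hx q) (wt_pos k q).le), smul_eq_mul]
  ring

lemma toMeasure_apply {x : L1} {A : Set ℝ} (hA : MeasurableSet A) :
    toMeasure k x A = ∑' q : ℚ, A.indicator (fun _ => ENNReal.ofReal (x q / wt k q)) (q : ℝ) := by
  rw [toMeasure, Measure.sum_apply _ hA]
  congr 1 with q
  rw [Measure.smul_apply, Measure.dirac_apply' _ hA, smul_eq_mul]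
  by_cases h : (q : ℝ) ∈ A <;> simp [h]

lemma toMeasure_le {x : L1} (hx : ∀ q, 0 ≤ x q) {A : Set ℝ} (hA : MeasurableSet A) {φ : ℚ → ℝ}
    (hφ : Tame k φ) (h0 : ∀ q, 0 ≤ φ q) (h : ∀ q : ℚ, (q : ℝ) ∈ A → x q ≠ 0 → 1 ≤ φ q) :
    toMeasure k x A ≤ ENNReal.ofReal (pair k φ x) := by
  rw [toMeasure_apply hA, pair, ENNReal.ofReal_tsum_of_nonneg
    (fun q => mul_nonneg (hx q) (div_nonneg (h0 q) (wt_pos k q).le)) (summable_pair hφ x)]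
  refine ENNReal.tsum_le_tsum fun q => ?_
  by_cases hq : (q : ℝ) ∈ A
  · rw [indicator_of_mem hq]
    refine ENNReal.ofReal_le_ofReal ?_
    by_cases hxq : x q = 0
    · simp [hxq]
    · have := h q hq hxq
      have hw := wt_pos k q
      rw [div_eq_mul_one_div]
      gcongr
      exact hx q
  · rw [indicator_of_notMem hq]; exact zero_le

lemma le_toMeasure {x : L1} (hx : ∀ q, 0 ≤ x q) {A : Set ℝ} (hA : MeasurableSet A) {φ : ℚ → ℝ}
    (hφ : Tame k φ) (h0 : ∀ q, 0 ≤ φ q) (h1 : ∀ q, φ q ≤ 1)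
    (h : ∀ q : ℚ, (q : ℝ) ∉ A → x q ≠ 0 → φ q = 0) :
    ENNReal.ofReal (pair k φ x) ≤ toMeasure k x A := by
  rw [toMeasure_apply hA, pair, ENNReal.ofReal_tsum_of_nonneg
    (fun q => mul_nonneg (hx q) (div_nonneg (h0 q) (wt_pos k q).le)) (summable_pair hφ x)]
  refine ENNReal.tsum_le_tsum fun q => ?_
  by_cases hq : (q : ℝ) ∈ A
  · rw [indicator_of_mem hq]
    refine ENNReal.ofReal_le_ofReal ?_
    have hw := wt_pos k q
    rw [div_eq_mul_one_div (x q)]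
    gcongr
    · exact hx q
    · exact h1 q
  · rw [indicator_of_notMem hq]
    by_cases hxq : x q = 0
    · simp [hxq]
    · simp [h q hq hxq]

lemma toMeasure_univ {x : L1} (hx : ∀ q, 0 ≤ x q) :
    toMeasure k x univ = ENNReal.ofReal (mass k x) :=
  (toMeasure_le hx .univ tame_one (fun _ => zero_le_one) fun _ _ _ => le_rfl).antisymm
    (le_toMeasure hx .univ tame_one (fun _ => zero_le_one) (fun _ => le_rfl)
      fun _ hq => absurd (mem_univ _) hq)

lemma toMeasure_eq_zero {x : L1} {A : Set ℝ} (hA : MeasurableSet A)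
    (h : ∀ q : ℚ, (q : ℝ) ∈ A → x q = 0) : toMeasure k x A = 0 := by
  rw [toMeasure_apply hA, ENNReal.tsum_eq_zero]
  intro q
  by_cases hq : (q : ℝ) ∈ A
  · simp [h q hq]
  · exact indicator_of_notMem hq _

lemma memMplus_toMeasure {ρ : ℝ} (hρ : -ρ ≤ k) {x : L1} (hx : ∀ q, 0 ≤ x q)
    (hx0 : ∀ q ≤ 0, x q = 0) : MemMplus ρ (toMeasure k x) := by
  refine ⟨toMeasure_eq_zero measurableSet_Iio fun q hq => hx0 q (by exact_mod_cast (mem_Iio.1 hq).le),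
    2 ^ k * ‖x‖, fun R hR => ?_⟩
  have h1R : 1 ≤ 1 + R := by linarith
  have hc : 0 < (1 + R) ^ ρ := by positivity
  have hk : 0 < (2 : ℝ) ^ k := by positivity
  have hinv : 1 ≤ (1 + R) ^ ρ * (1 + R) ^ k := by
    rw [← Real.rpow_natCast, ← Real.rpow_add (by linarith)]
    exact Real.one_le_rpow h1R (by linarith)
  have hmaj : ∀ q : ℚ, (q : ℝ) ∈ Icc (R / 2) R → 1 ≤ 2 ^ k * (1 + R) ^ ρ * R * wt k q := by
    intro q hq
    have hq0 : (0 : ℝ) < q := lt_of_lt_of_le (by positivity) hq.1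
    have hw : wt k q = (1 + q : ℝ) ^ k + (q : ℝ)⁻¹ := by rw [wt, abs_of_pos hq0]
    rcases le_total 1 R with h1 | h1
    · have h2 : ((1 + R) / 2) ^ k ≤ wt k q := by
        rw [hw]
        have : ((1 + R) / 2) ^ k ≤ (1 + q : ℝ) ^ k := by
          gcongr; linarith [hq.1]
        linarith [inv_pos.2 hq0]
      calc 1 ≤ (1 + R) ^ ρ * (1 + R) ^ k := hinv
        _ = 2 ^ k * (1 + R) ^ ρ * 1 * ((1 + R) / 2) ^ k := by rw [div_pow]; field_simp
        _ ≤ _ := by gcongr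
    · have h2 : R⁻¹ ≤ wt k q := by
        rw [hw]
        have := inv_anti₀ hq0 hq.2
        have : 0 < (1 + q : ℝ) ^ k := by positivity
        linarith
      calc 1 ≤ (1 + R) ^ ρ * (1 + R) ^ k := hinv
        _ ≤ (1 + R) ^ ρ * 2 ^ k := by gcongr; linarith
        _ = 2 ^ k * (1 + R) ^ ρ * R * R⁻¹ := by field_simp
        _ ≤ _ := by gcongr
  refine (toMeasure_le hx measurableSet_Icc
    (φ := fun q => 2 ^ k * (1 + R) ^ ρ * R * wt k q) (tame_const_mul tame_wt _) (fun q => ?_)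
    fun q hq _ => hmaj q hq).trans (ENNReal.ofReal_le_ofReal ?_)
  · have := wt_pos k q
    positivity
  · rw [pair_const_mul, pair_wt_eq_norm hx]
    exact le_of_eq (by ring)


/-! ### The weak formulation -/

lemma abs_pair_le_of_bounded {φ : ℚ → ℝ} {C : ℝ} (h : ∀ q, |φ q| ≤ C) (x : L1) :
    |pair k φ x| ≤ C * ‖x‖ :=
  abs_pair_le (fun q => (h q).trans
    (le_mul_of_one_le_right ((abs_nonneg _).trans (h q)) (one_le_wt k q))) x

lemma pair_fun_sub {φ ψ : ℚ → ℝ} (hφ : Tame k φ) (hψ : Tame k ψ) (x : L1) :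
    pair k (fun q => φ q - ψ q) x = pair k φ x - pair k ψ x := by
  unfold pair
  rw [← (summable_pair hφ x).tsum_sub (summable_pair hψ x)]
  congr 1 with q
  ring

/-- The collision term encoded by a state, tested against `φ`. -/
def collision (k : ℕ) (φ : ℚ → ℝ) (x : L1) : ℝ := cubic (fun p => ker p / wt3 k p * br φ p) x

lemma collisionInt_toMeasure {x : L1} (hx : ∀ q, 0 ≤ x q) {ψ : ℝ → ℝ} {C : ℝ}
    (hψ : ∀ q : ℚ, |ψ q| ≤ C) :
    collisionInt 0 (toMeasure k x) ψ = collision k (fun q => ψ q) x := by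
  have hs := summable_cubic (norm_ker_br_le (k := k) (φ := fun q => ψ q) hψ) x
  have e : ∀ a b c : ℚ, x a * x b * x c * (ker (a, b, c) / wt3 k (a, b, c) *
      br (fun q => ψ q) (a, b, c)) = x a * ((x b * ((x c * ((PhiKer 0 a b c / √(a * b * c) *
        (ψ (a + b - c) + ψ c - ψ a - ψ b)) / wt k c)) / wt k b)) / wt k a) := fun a b c => by
    have h1 := (wt_pos k a).ne'
    have h2 := (wt_pos k b).ne'
    have h3 := (wt_pos k c).ne'
    simp only [ker, wt3, br, out]
    push_cast
    generalize PhiKer 0 (a : ℝ) b c / √(a * b * c) = K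
    field_simp
  unfold collisionInt collision cubic
  simp only [smul_eq_mul] at hs ⊢
  rw [hs.tsum_prod]
  simp_rw [integral_toMeasure hx]
  unfold pair
  congr 1 with a
  rw [(hs.prod_factor a).tsum_prod]
  rw [← tsum_div_const, ← tsum_mul_left]
  congr 1 with b
  rw [← tsum_div_const, ← tsum_mul_left, ← tsum_div_const, ← tsum_mul_left]
  congr 1 with c
  exact (e a b c).symm

lemma abs_collision_sub_le {φ ψ : ℚ → ℝ} {C : ℝ} (h : ∀ q, |φ q - ψ q| ≤ C)
    {A : ℝ} (hφ : ∀ q, |φ q| ≤ A) (hψ : ∀ q, |ψ q| ≤ A) (x : L1) :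
    |collision k φ x - collision k ψ x| ≤ 4 * C * ‖x‖ ^ 3 := by
  have e : collision k φ x - collision k ψ x = collision k (fun q => φ q - ψ q) x := by
    unfold collision cubic
    rw [← (summable_cubic (norm_ker_br_le hφ) x).tsum_sub (summable_cubic (norm_ker_br_le hψ) x)]
    congr 1 with p
    simp only [br, smul_eq_mul]
    ring
  rw [e]
  exact norm_cubic_le (norm_ker_br_le h) x

lemma abs_collision_sub_le_right {φ : ℚ → ℝ} {C R : ℝ} (h : ∀ q, |φ q| ≤ C) {x y : L1}
    (hx : ‖x‖ ≤ R) (hy : ‖y‖ ≤ R) :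
    |collision k φ x - collision k φ y| ≤ 3 * (4 * C) * R ^ 2 * ‖x - y‖ :=
  norm_cubic_sub_le (by linarith [(abs_nonneg _).trans (h 0)]) (norm_ker_br_le h) hx hy

section TimeDependent

variable {Ψ : ℝ → ℝ → ℝ} {C : ℝ}

lemma exists_delta (hc : Continuous (Function.uncurry Ψ))
    (hs : HasCompactSupport (Function.uncurry Ψ)) {ε : ℝ} (hε : 0 < ε) :
    ∃ δ > 0, ∀ s t : ℝ, |s - t| < δ → ∀ ω, |Ψ s ω - Ψ t ω| < ε := by
  obtain ⟨δ, hδ, h⟩ :=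
    Metric.uniformContinuous_iff.1 (hs.uniformContinuous_of_continuous hc) ε hε
  refine ⟨δ, hδ, fun s t hst ω => ?_⟩
  have := @h (s, ω) (t, ω) (by rw [Prod.dist_eq]; simpa [Real.dist_eq, hδ] using hst)
  simpa [Real.dist_eq] using this

lemma exists_abs_le (hc : Continuous (Function.uncurry Ψ))
    (hs : HasCompactSupport (Function.uncurry Ψ)) : ∃ C, ∀ t ω, |Ψ t ω| ≤ C := by
  obtain ⟨C, hC⟩ := hs.exists_bound_of_continuous hc
  exact ⟨C, fun t ω => hC (t, ω)⟩

/-- The functional on states given by a bounded time-dependent function. -/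
def pairT (k : ℕ) (h : ∀ t ω, |Ψ t ω| ≤ C) (t : ℝ) : L1 →L[ℝ] ℝ :=
  pairL (k := k) (fun q => Ψ t q) (tame_of_bounded (C := C) fun q => h t q)

lemma pairT_apply (h : ∀ t ω, |Ψ t ω| ≤ C) (t : ℝ) (x : L1) :
    pairT k h t x = pair k (fun q => Ψ t q) x := rfl

lemma continuous_pairT (hc : Continuous (Function.uncurry Ψ))
    (hs : HasCompactSupport (Function.uncurry Ψ)) (h : ∀ t ω, |Ψ t ω| ≤ C) :
    Continuous (pairT k h) := by
  refine Metric.continuous_iff.2 fun t ε hε => ?_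
  obtain ⟨δ, hδ, hd⟩ := exists_delta hc hs (half_pos hε)
  refine ⟨δ, hδ, fun s hst => ?_⟩
  rw [dist_eq_norm]
  refine lt_of_le_of_lt (ContinuousLinearMap.opNorm_le_bound _ (half_pos hε).le fun x => ?_)
    (half_lt_self hε)
  rw [sub_apply, pairT_apply, pairT_apply,
    ← pair_fun_sub (tame_of_bounded fun q => h s q) (tame_of_bounded fun q => h t q)]
  exact abs_pair_le_of_bounded (fun q => (hd s t hst q).le) x

lemma continuousOn_collision (hc : Continuous (Function.uncurry Ψ))
    (hs : HasCompactSupport (Function.uncurry Ψ)) {f : ℝ → L1} {S : Set ℝ}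
    (hf : ContinuousOn f S) : ContinuousOn (fun t => collision k (fun q => Ψ t q) (f t)) S := by
  intro t ht
  obtain ⟨C, hC⟩ := exists_abs_le hc hs
  have hev : ∀ᶠ s in 𝓝[S] t, ‖f s‖ ≤ ‖f t‖ + 1 :=
    (hf t ht).norm.eventually_le_const (lt_add_one ‖f t‖)
  have h1 : Tendsto (fun s => collision k (fun q => Ψ t q) (f s)) (𝓝[S] t)
      (𝓝 (collision k (fun q => Ψ t q) (f t))) := by
    have h0 : Tendsto (fun s => 3 * (4 * C) * (‖f t‖ + 1) ^ 2 * ‖f s - f t‖) (𝓝[S] t) (𝓝 0) := by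
      have := (tendsto_iff_norm_sub_tendsto_zero.1 (hf t ht)).const_mul
        (3 * (4 * C) * (‖f t‖ + 1) ^ 2)
      rwa [mul_zero] at this
    refine tendsto_iff_norm_sub_tendsto_zero.2 (squeeze_zero' (.of_forall fun _ => norm_nonneg _)
      (hev.mono fun s hs => ?_) h0)
    exact abs_collision_sub_le_right (fun q => hC t q) hs (by linarith)
  have h2 : Tendsto (fun s => collision k (fun q => Ψ s q) (f s)
      - collision k (fun q => Ψ t q) (f s)) (𝓝[S] t) (𝓝 0) := by
    rw [Metric.tendsto_nhds]
    intro ε hε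
    have hK : 0 < 4 * (‖f t‖ + 1) ^ 3 := by positivity
    obtain ⟨δ, hδ, hd⟩ := exists_delta hc hs (div_pos (half_pos hε) hK)
    filter_upwards [hev, mem_nhdsWithin_of_mem_nhds (Metric.ball_mem_nhds t hδ)] with s hsf hst
    rw [Real.dist_eq, sub_zero]
    refine (abs_collision_sub_le (fun q => (hd s t hst q).le) (fun q => hC s q)
      (fun q => hC t q) _).trans_lt ?_
    calc 4 * (ε / 2 / (4 * (‖f t‖ + 1) ^ 3)) * ‖f s‖ ^ 3
        ≤ 4 * (ε / 2 / (4 * (‖f t‖ + 1) ^ 3)) * (‖f t‖ + 1) ^ 3 := by gcongr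
      _ = ε / 2 := by field_simp
      _ < ε := half_lt_self hε
  have h3 := h2.add h1
  simp only [sub_add_cancel, zero_add] at h3
  exact h3

lemma hasDerivAt_pairT {D : ℝ → ℝ → ℝ} {C' : ℝ}
    (hD : ∀ t ω, HasDerivAt (fun s => Ψ s ω) (D t ω) t)
    (hc : Continuous (Function.uncurry D)) (hs : HasCompactSupport (Function.uncurry D))
    (h : ∀ t ω, |Ψ t ω| ≤ C) (h' : ∀ t ω, |D t ω| ≤ C') (t : ℝ) :
    HasDerivAt (pairT k h) (pairT k h' t) t := by
  rw [hasDerivAt_iff_isLittleO, Asymptotics.isLittleO_iff]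
  intro ε hε
  obtain ⟨δ, hδ, hd⟩ := exists_delta hc hs hε
  filter_upwards [Metric.ball_mem_nhds t hδ] with s hst
  have key : ∀ ω, |Ψ s ω - Ψ t ω - (s - t) * D t ω| ≤ ε * |s - t| := fun ω => by
    have := (convex_ball t δ).norm_image_sub_le_of_norm_hasDerivWithin_le
      (f := fun r => Ψ r ω - r * D t ω) (f' := fun r => D r ω - D t ω) (C := ε) (x := t) (y := s)
      (fun r _ => ((hD r ω).sub (by simpa using (hasDerivAt_id r).mul_const (D t ω))).hasDerivWithinAt)
      (fun r hr => (hd r t hr ω).le) (Metric.mem_ball_self hδ) hst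
    simp only [Real.norm_eq_abs] at this
    convert this using 2
    ring
  refine ContinuousLinearMap.opNorm_le_bound _ (by positivity) fun x => ?_
  have e : (pairT k h s - pairT k h t - (s - t) • pairT k h' t) x
      = pair k (fun q => Ψ s q - Ψ t q - (s - t) * D t q) x := by
    have t1 : Tame k fun q => Ψ s q := tame_of_bounded fun q => h s q
    have t2 : Tame k fun q => Ψ t q := tame_of_bounded fun q => h t q
    have t3 : Tame k fun q => D t q := tame_of_bounded fun q => h' t q
    rw [pair_fun_sub (φ := fun q => Ψ s q - Ψ t q) ?_ (tame_const_mul t3 _), pair_fun_sub t1 t2,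
      pair_const_mul]
    · rfl
    · exact tame_of_bounded (C := C + C) fun q => (abs_sub _ _).trans (add_le_add (h s q) (h t q))
  rw [e]
  exact abs_pair_le_of_bounded (fun q => key q) x

end TimeDependent

lemma _root_.IsTestFun.exists_deriv {φ : ℝ → ℝ → ℝ} (h : IsTestFun φ) :
    ∃ D : ℝ → ℝ → ℝ, (∀ t ω, HasDerivAt (fun s => φ s ω) (D t ω) t) ∧
      Continuous (Function.uncurry D) ∧ HasCompactSupport (Function.uncurry D) := by
  refine ⟨fun t ω => fderiv ℝ (Function.uncurry φ) (t, ω) (1, 0), fun t ω => ?_, ?_, ?_⟩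
  · have h1 := (h.1.differentiable (by norm_num) (t, ω)).hasFDerivAt
    have h2 : HasDerivAt (fun s : ℝ => (s, ω)) (1, 0) t :=
      (hasDerivAt_id t).prodMk (hasDerivAt_const t ω)
    exact h1.comp_hasDerivAt t h2
  · exact (h.1.continuous_fderiv (by norm_num)).clm_apply continuous_const
  · exact h.2.fderiv_apply ℝ (1, 0)

section Limit

variable {φ D : ℝ → ℝ → ℝ} {C C' : ℝ}

/-- The time derivative of the pairing with a test function, along a solution. -/
def rate (k : ℕ) (φ D : ℝ → ℝ → ℝ) (t : ℝ) (x : L1) : ℝ :=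
  pair k (fun q => D t q) x + collision k (fun q => φ t q) x

lemma continuousOn_rate (hφc : Continuous (Function.uncurry φ))
    (hφs : HasCompactSupport (Function.uncurry φ)) (hDc : Continuous (Function.uncurry D))
    (hDs : HasCompactSupport (Function.uncurry D)) {f : ℝ → L1} {S : Set ℝ}
    (hf : ContinuousOn f S) : ContinuousOn (fun t => rate k φ D t (f t)) S := by
  obtain ⟨C, hC⟩ := exists_abs_le hDc hDs
  exact ((continuous_pairT (k := k) hDc hDs hC).continuousOn.clm_apply hf).add
    (continuousOn_collision hφc hφs hf)

lemma abs_rate_sub_le (hφ : ∀ t ω, |φ t ω| ≤ C) (hD : ∀ t ω, |D t ω| ≤ C') {R t : ℝ} {x y : L1}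
    (hx : ‖x‖ ≤ R) (hy : ‖y‖ ≤ R) :
    |rate k φ D t x - rate k φ D t y| ≤ (C' + 3 * (4 * C) * R ^ 2) * ‖x - y‖ := by
  have h1 := abs_pair_le_of_bounded (k := k) (fun q : ℚ => hD t q) (x - y)
  rw [pair_sub _ (tame_of_bounded fun q : ℚ => hD t q)] at h1
  have h2 := abs_collision_sub_le_right (k := k) (fun q : ℚ => hφ t q) hx hy
  have e : rate k φ D t x - rate k φ D t y
      = (pair k (fun q => D t q) x - pair k (fun q => D t q) y)
        + (collision k (fun q => φ t q) x - collision k (fun q => φ t q) y) := by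
    unfold rate; ring
  rw [e]
  refine (abs_add_le _ _).trans ?_
  linarith

lemma Sol.integral_rate {f : ℝ → L1} {T : ℝ} (h : Sol k N T f)
    (hD : ∀ t ω, HasDerivAt (fun s => φ s ω) (D t ω) t)
    (hφc : Continuous (Function.uncurry φ)) (hφs : HasCompactSupport (Function.uncurry φ))
    (hDc : Continuous (Function.uncurry D)) (hDs : HasCompactSupport (Function.uncurry D))
    {t : ℝ} (ht : t ∈ Icc 0 T) :
    ∫ r in (0 : ℝ)..t, rate k φ D r (f r)
      = pair k (fun q => φ t q) (f t) - pair k (fun q => φ 0 q) (f 0) := by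
  obtain ⟨C, hC⟩ := exists_abs_le hφc hφs
  obtain ⟨C', hC'⟩ := exists_abs_le hDc hDs
  have hsub : Icc 0 t ⊆ Icc 0 T := Icc_subset_Icc_right ht.2
  have hd : ∀ r ∈ Icc 0 T, HasDerivWithinAt (fun r => pair k (fun q => φ r q) (f r))
      (rate k φ D r (f r)) (Icc 0 T) r := fun r hr => by
    have := (hasDerivAt_pairT (k := k) hD hDc hDs hC hC' r).hasDerivWithinAt.clm_apply
      (h.deriv r hr)
    rw [pairT_apply, pairT_apply, pair_Q_eq_ker (tame_of_bounded fun q => hC r q) (h.supp r hr)]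
      at this
    exact this
  refine intervalIntegral.integral_eq_sub_of_hasDeriv_right
    (f := fun r => pair k (fun q => φ r q) (f r)) ?_ (fun r hr => ?_) ?_
  · rw [uIcc_of_le ht.1]
    exact (continuousOn_of_hasDerivWithinAt hd).mono hsub
  · rw [min_eq_left ht.1, max_eq_right ht.1] at hr
    exact (hasDerivWithinAt_Ici hd r ⟨hr.1.le, hr.2.trans_le ht.2⟩).mono Ioi_subset_Ici_self
  · refine ContinuousOn.intervalIntegrable ?_
    rw [uIcc_of_le ht.1]
    exact (continuousOn_rate hφc hφs hDc hDs h.continuousOn).mono hsub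

end Limit

lemma tendsto_mesh : Tendsto (fun n : ℕ => (mesh n : ℝ)) atTop (𝓝 0) := by
  simp_rw [mesh_cast]
  exact tendsto_inv_atTop_zero.comp (tendsto_pow_atTop_atTop_of_one_lt one_lt_two)

lemma Cascade.integral_rate {f : ℕ → ℝ → L1} {T τ s : ℕ → ℝ} (h : Cascade k f T τ s)
    {F : ℝ → L1} (hF : Continuous F)
    (hclose : ∀ n, ∀ t ∈ Icc 0 (T n), ‖f n t - F t‖ ≤ 2 * mesh n) {φ D : ℝ → ℝ → ℝ}
    (hD : ∀ t ω, HasDerivAt (fun s => φ s ω) (D t ω) t)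
    (hφc : Continuous (Function.uncurry φ)) (hφs : HasCompactSupport (Function.uncurry φ))
    (hDc : Continuous (Function.uncurry D)) (hDs : HasCompactSupport (Function.uncurry D))
    {t : ℝ} (ht : 0 ≤ t) :
    ∫ r in (0 : ℝ)..t, rate k φ D r (F r)
      = pair k (fun q => φ t q) (F t) - pair k (fun q => φ 0 q) (F 0) := by
  obtain ⟨C, hC⟩ := exists_abs_le hφc hφs
  obtain ⟨C', hC'⟩ := exists_abs_le hDc hDs
  have hC0 : 0 ≤ C := (abs_nonneg _).trans (hC 0 0)
  have hC0' : 0 ≤ C' := (abs_nonneg _).trans (hC' 0 0)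
  obtain ⟨R, hR⟩ := isCompact_Icc.exists_bound_of_continuousOn (hF.continuousOn (s := Icc 0 t))
  set K := C' + 3 * (4 * C) * (R + 2) ^ 2
  have hK : 0 ≤ K := by positivity
  have hpair : ∀ r, ∀ n, r ∈ Icc 0 (T n) →
      |pair k (fun q => φ r q) (f n r) - pair k (fun q => φ r q) (F r)| ≤ C * (2 * mesh n) :=
    fun r n hr => by
      rw [← pair_sub _ (tame_of_bounded fun q => hC r q)]
      exact (abs_pair_le_of_bounded (fun q => hC r q) _).trans (by gcongr; exact hclose n r hr)
  have hint : ∀ n, t ≤ T n → |(∫ r in (0 : ℝ)..t, rate k φ D r (f n r))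
      - ∫ r in (0 : ℝ)..t, rate k φ D r (F r)| ≤ K * (2 * mesh n) * t := fun n hn => by
    have hsub : Icc 0 t ⊆ Icc 0 (T n) := Icc_subset_Icc_right hn
    rw [← intervalIntegral.integral_sub]
    · have := intervalIntegral.norm_integral_le_of_norm_le_const (a := 0) (b := t)
        (f := fun r => rate k φ D r (f n r) - rate k φ D r (F r)) (C := K * (2 * mesh n))
        fun r hr => ?_
      · rwa [sub_zero, abs_of_nonneg ht] at this
      · rw [uIoc_of_le ht] at hr
        have hr' : r ∈ Icc 0 t := ⟨hr.1.le, hr.2⟩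
        have hc := hclose n r (hsub hr')
        have hm := mesh_cast_le_one n
        have hFr := hR r hr'
        have hfr : ‖f n r‖ ≤ R + 2 := by
          have := norm_add_le (f n r - F r) (F r)
          rw [sub_add_cancel] at this
          linarith
        exact (abs_rate_sub_le hC hC' hfr (by linarith)).trans (by gcongr)
    · refine ContinuousOn.intervalIntegrable ?_
      rw [uIcc_of_le ht]
      exact (continuousOn_rate hφc hφs hDc hDs (h.stage n).sol.continuousOn).mono hsub
    · exact (continuousOn_rate hφc hφs hDc hDs hF.continuousOn).intervalIntegrable
  refine eq_of_abs_sub_nonpos (ge_of_tendsto (f := fun n : ℕ => (K * t + 2 * C) * (2 * mesh n))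
    (by simpa using (tendsto_mesh.const_mul 2).const_mul (K * t + 2 * C))
    ((h.tendsto_time.eventually_ge_atTop t).mono fun n hn => ?_))
  have h1 := hint n hn
  have h2 := hpair t n ⟨ht, hn⟩
  have h3 := hpair 0 n ⟨le_rfl, ht.trans hn⟩
  rw [(h.stage n).sol.integral_rate hD hφc hφs hDc hDs ⟨ht, hn⟩] at h1
  rw [abs_le] at h1 h2 h3 ⊢
  constructor <;> linarith [h1.1, h1.2, h2.1, h2.2, h3.1, h3.2]

theorem Cascade.isWeakSolution {f : ℕ → ℝ → L1} {T τ s : ℕ → ℝ} (h : Cascade k f T τ s)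
    {F : ℝ → L1} (hF : Continuous F) (hF0 : ∀ t q, 0 ≤ F t q) (hF1 : ∀ t, ∀ q ≤ 0, F t q = 0)
    (hclose : ∀ n, ∀ t ∈ Icc 0 (T n), ‖f n t - F t‖ ≤ 2 * mesh n) {ρ : ℝ} (hρ : -ρ ≤ k) :
    IsWeakSolution ρ 0 (toMeasure k (F 0)) fun t => toMeasure k (F t) := by
  refine ⟨fun t _ => memMplus_toMeasure hρ (hF0 t) (hF1 t), fun φ hφc hφs => ?_, rfl,
    fun φ hφ t ht => ?_⟩
  · obtain ⟨C, hC⟩ := hφs.exists_bound_of_continuous hφc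
    simp_rw [integral_toMeasure (hF0 _)]
    exact ((pairL _ (tame_of_bounded fun q => hC q)).continuous.comp hF).continuousOn
  · obtain ⟨D, hD, hDc, hDs⟩ := hφ.exists_deriv
    obtain ⟨C, hC⟩ := exists_abs_le hφ.1.continuous hφ.2
    obtain ⟨C', hC'⟩ := exists_abs_le hDc hDs
    have key := h.integral_rate hF hclose hD hφ.1.continuous hφ.2 hDc hDs ht
    simp_rw [collisionInt_toMeasure (hF0 _) (fun q => hC _ q), integral_toMeasure (hF0 _),
      (hD _ _).deriv, ← intervalIntegral.integral_of_le ht]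
    rw [← key, ← intervalIntegral.integral_add]
    · rfl
    · exact (((continuous_pairT (k := k) hDc hDs hC').clm_apply hF).intervalIntegrable _ _)
    · exact (continuousOn_collision hφ.1.continuous hφ.2 hF.continuousOn).intervalIntegrable


/-! ### Long-time behaviour -/

namespace Cascade

variable {f : ℕ → ℝ → L1} {T τ s : ℕ → ℝ} {F : ℝ → L1}

/-- The times at which the solution is concentrated near a single point. -/
def restTimes (T τ : ℕ → ℝ) : Set ℝ := {t | ∃ n, t ∈ Icc (T n) (τ n)}

lemma exists_mem_Ico (h : Cascade k f T τ s) {M : ℕ} {X : ℝ} (hX : T M ≤ X) :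
    ∃ n, M ≤ n ∧ X ∈ Ico (T n) (T (n + 1)) := by
  have hex : ∃ n, X < T n := (h.tendsto_time.eventually_gt_atTop X).exists
  classical
  have hpos : Nat.find hex ≠ 0 := fun h0 => by
    have h1 := Nat.find_spec hex
    rw [h0] at h1
    linarith [h.time_monotone (Nat.zero_le M)]
  obtain ⟨n, hn⟩ := Nat.exists_eq_succ_of_ne_zero hpos
  have h1 := Nat.find_spec hex
  rw [hn] at h1
  refine ⟨n, ?_, not_lt.1 (Nat.find_min hex (by omega)), h1⟩
  by_contra! hlt
  linarith [h.time_monotone (show n + 1 ≤ M by omega)]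

lemma le_volume_restTimes (h : Cascade k f T τ s) {M : ℕ} {X : ℝ} (hX : T (M + 1) ≤ X) :
    X * (1 - 2 / (M + 1)) ≤ volume.real (restTimes T τ ∩ Icc 0 X) := by
  obtain ⟨n, hn, hXn⟩ := h.exists_mem_Ico hX
  obtain ⟨n, rfl⟩ : ∃ j, n = j + 1 := ⟨n - 1, by omega⟩
  have hMn : (M : ℝ) ≤ n := by exact_mod_cast Nat.le_of_succ_le_succ hn
  have hT0 : 0 ≤ T n := (h.stage n).time_nonneg
  have hl := (h.link n).long
  have hl' := (h.link (n + 1)).long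
  have h1 := (h.link n).le_tau
  have h2 := (h.link n).tau_le
  have h1' := (h.link (n + 1)).le_tau
  have h2' := (h.link (n + 1)).tau_le
  push_cast at hl'
  have hcover : Icc 0 X ⊆ (restTimes T τ ∩ Icc 0 X) ∪ (Icc 0 (T n) ∪ (Icc (τ n) (T (n + 1)) ∪
      Icc (τ (n + 1)) X)) := fun t ht => by
    by_cases a1 : t ≤ T n
    · exact Or.inr (Or.inl ⟨ht.1, a1⟩)
    by_cases a2 : t ≤ τ n
    · exact Or.inl ⟨⟨n, (not_le.1 a1).le, a2⟩, ht⟩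
    by_cases a3 : t ≤ T (n + 1)
    · exact Or.inr (Or.inr (Or.inl ⟨(not_le.1 a2).le, a3⟩))
    by_cases a4 : t ≤ τ (n + 1)
    · exact Or.inl ⟨⟨n + 1, (not_le.1 a3).le, a4⟩, ht⟩
    · exact Or.inr (Or.inr (Or.inr ⟨(not_le.1 a4).le, ht.2⟩))
  have hfin : volume (restTimes T τ ∩ Icc 0 X) ≠ ∞ :=
    measure_ne_top_of_subset inter_subset_right (by simp)
  have hm := (measureReal_mono (μ := volume) hcover (by
    simp [hfin])).trans ((measureReal_union_le _ _).trans
      (add_le_add_right ((measureReal_union_le _ _).trans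
        (add_le_add_right (measureReal_union_le _ _) _)) _))
  simp only [Real.volume_real_Icc, sub_zero] at hm
  have hX0 : 0 ≤ X := by linarith [hXn.1]
  have hn1 : (0 : ℝ) < M + 1 := by positivity
  have e1 : T n + (T (n + 1) - τ n) ≤ X / (M + 1) := by
    rw [le_div_iff₀ hn1]
    nlinarith [hXn.1]
  have e2 : max (X - τ (n + 1)) 0 ≤ X / (M + 1) := by
    rcases le_total X (τ (n + 1)) with hc | hc
    · rw [max_eq_right (by linarith)]; positivity
    · rw [max_eq_left (by linarith), le_div_iff₀ hn1]
      nlinarith [hXn.2]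
  rw [max_eq_left hX0, max_eq_left hT0, max_eq_left (sub_nonneg.2 h2)] at hm
  have e3 : X * (1 - 2 / (M + 1)) = X - X / (M + 1) - X / (M + 1) := by ring
  linarith

lemma tendsto_density (h : Cascade k f T τ s) :
    Tendsto (fun X : ℝ => (volume (restTimes T τ ∩ Icc 0 X)).toReal / X) atTop (𝓝 1) := by
  rw [Metric.tendsto_atTop]
  intro ε hε
  obtain ⟨M, hM⟩ := exists_nat_gt (2 / ε)
  refine ⟨max (T (M + 1)) 1, fun X hX => ?_⟩
  have hX0 : 0 < X := zero_lt_one.trans_le ((le_max_right _ _).trans hX)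
  have h1 := h.le_volume_restTimes ((le_max_left _ _).trans hX)
  have h2 : volume.real (restTimes T τ ∩ Icc 0 X) ≤ X :=
    (measureReal_mono inter_subset_right (by simp)).trans (by simp [hX0.le])
  rw [measureReal_def] at h1 h2
  have h3 : 2 / ((M : ℝ) + 1) < ε := by
    rw [div_lt_iff₀ hε] at hM
    rw [div_lt_iff₀ (by positivity)]
    linarith
  rw [Real.dist_eq, abs_lt]
  constructor
  · have : 1 - 2 / ((M : ℝ) + 1) ≤ (volume (restTimes T τ ∩ Icc 0 X)).toReal / X := by
      rw [le_div_iff₀ hX0]; linarith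
    linarith
  · have := (div_le_one hX0).2 h2
    linarith

lemma abs_pair_sub_le (hclose : ∀ n, ∀ t ∈ Icc 0 (T n), ‖f n t - F t‖ ≤ 2 * mesh n) {n : ℕ} {t : ℝ}
    (ht : t ∈ Icc 0 (T n)) {φ : ℚ → ℝ} (hφ : ∀ q, |φ q| ≤ 1) :
    |pair k φ (f n t) - pair k φ (F t)| ≤ 2 * mesh n := by
  rw [← pair_sub _ (tame_of_bounded hφ)]
  exact (abs_pair_le_of_bounded hφ _).trans (by rw [one_mul]; exact hclose n t ht)

lemma abs_mass_sub_le (h : Cascade k f T τ s)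
    (hclose : ∀ n, ∀ t ∈ Icc 0 (T n), ‖f n t - F t‖ ≤ 2 * mesh n) {n : ℕ} {t : ℝ}
    (ht : t ∈ Icc 0 (T n)) : |mass k (f n 0) - mass k (F t)| ≤ 2 * mesh n := by
  rw [← (h.stage n).sol.mass_eq ht]
  exact abs_pair_sub_le hclose ht fun q => by simp

lemma one_le_mass (h : Cascade k f T τ s)
    (hclose : ∀ n, ∀ t ∈ Icc 0 (T n), ‖f n t - F t‖ ≤ 2 * mesh n) : 1 ≤ mass k (F 0) := by
  refine le_of_tendsto' (f := fun n : ℕ => 1 - 2 * (mesh n : ℝ))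
    (by simpa using (tendsto_mesh.const_mul 2).const_sub 1) fun n => ?_
  have h1 := (abs_le.1 (h.abs_mass_sub_le hclose ⟨le_rfl, (h.stage n).time_nonneg⟩)).2
  linarith [(h.stage n).one_le_mass]

lemma mass_le_four (h : Cascade k f T τ s)
    (hclose : ∀ n, ∀ t ∈ Icc 0 (T n), ‖f n t - F t‖ ≤ 2 * mesh n) {t : ℝ} (ht : 0 ≤ t) :
    mass k (F t) ≤ 4 := by
  obtain ⟨n, hn⟩ := (h.tendsto_time.eventually_ge_atTop t).exists
  have h1 := (abs_le.1 (h.abs_mass_sub_le hclose ⟨ht, hn⟩)).1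
  linarith [(h.stage n).mass_le, mesh_cast_le_one n, mesh_cast_pos n]

theorem pulsating (h : Cascade k f T τ s) (hF0 : ∀ t q, 0 ≤ F t q)
    (hclose : ∀ n, ∀ t ∈ Icc 0 (T n), ‖f n t - F t‖ ≤ 2 * mesh n) :
    Pulsating (mass k (F 0)) fun t => toMeasure k (F t) := by
  have hm1 := h.one_le_mass hclose
  choose! i hi using fun (t : ℝ) (ht : t ∈ restTimes T τ) => ht
  have hmesh : Tendsto (fun t => (mesh (i t) : ℝ)) (atTop ⊓ 𝓟 (restTimes T τ)) (𝓝 0) := by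
    refine tendsto_mesh.comp (tendsto_atTop.2 fun M => ?_)
    rw [eventually_inf_principal]
    filter_upwards [eventually_gt_atTop (T M)] with t ht hA
    by_contra! hlt
    have h1 := (hi t hA).2.trans (h.link (i t)).tau_le
    linarith [h.time_monotone (show i t + 1 ≤ M by omega)]
  refine ⟨restTimes T τ, fun M => ?_, h.tendsto_density, fun t => mesh (i t),
    fun t => 3 * mesh (i t), fun t _ => ⟨mesh_cast_pos _, mul_pos three_pos (mesh_cast_pos _)⟩,
    by simpa using hmesh.const_mul 3, hmesh, fun t ht => ?_⟩
  · obtain ⟨n, hn⟩ := (h.tendsto_time.eventually_gt_atTop M).exists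
    exact ⟨T n, ⟨n, le_rfl, (h.link n).le_tau⟩, hn⟩
  · obtain ⟨ht1, ht2⟩ := hi t ht
    set n := i t
    have hmn := mesh_cast_pos n
    have hT0 := (h.stage n).time_nonneg
    have htT : t ∈ Icc 0 (T (n + 1)) := ⟨hT0.trans ht1, ht2.trans (h.link n).tau_le⟩
    have hsp : ∀ q, |spike (mesh n) q| ≤ 1 := abs_spike_le _
    have a1 := (abs_le.1 (abs_pair_sub_le (k := k) hclose htT hsp)).2
    have a2 := (abs_le.1 (h.abs_mass_sub_le hclose (n := n + 1)
      ⟨le_rfl, (h.stage (n + 1)).time_nonneg⟩)).1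
    have a3 := (h.link n).resting t ⟨ht1, ht2⟩
    have a4 := mesh_cast_succ n
    refine le_trans (ENNReal.ofReal_le_ofReal ?_) (le_toMeasure (hF0 t) measurableSet_Ioo
      (tame_spike (mesh n)) (spike_nonneg _) (spike_le_one _) fun q hq _ => if_neg fun hqm => ?_)
    · unfold atom at a3
      nlinarith
    · refine hq ?_
      rw [hqm]
      constructor <;> nlinarith

lemma toMeasure_ball_le (h : Cascade k f T τ s) (hF0 : ∀ t q, 0 ≤ F t q)
    (hclose : ∀ n, ∀ t ∈ Icc 0 (T n), ‖f n t - F t‖ ≤ 2 * mesh n) (n : ℕ) {a : ℝ} (ha : 0 < a) :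
    toMeasure k (F (s n)) ((fun ω => a * ω) ⁻¹' Metric.ball 1 (1 / 4))
      ≤ ENNReal.ofReal (mass k (F 0) / 2 + 3 * mesh (n + 1)) := by
  classical
  set S := (fun ω => a * ω) ⁻¹' Metric.ball (1 : ℝ) (1 / 4)
  have hS : MeasurableSet S := Metric.isOpen_ball.measurableSet.preimage (measurable_const_mul a)
  have hmem : ∀ x : ℝ, x ∈ S ↔ 3 / 4 < a * x ∧ a * x < 5 / 4 := fun x => by
    rw [mem_preimage, Metric.mem_ball, Real.dist_eq, abs_lt]
    constructor <;> rintro ⟨h1, h2⟩ <;> constructor <;> linarith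
  have hs := (h.link n).split_mem
  have hsT : s n ∈ Icc 0 (T (n + 1)) :=
    ⟨(h.stage n).time_nonneg.trans ((h.link n).le_tau.trans hs.1), hs.2⟩
  let φ : ℚ → ℝ := fun q => if (q : ℝ) ∈ S then 1 else 0
  have hφ0 : ∀ q, 0 ≤ φ q := fun q => by dsimp only [φ]; split_ifs <;> norm_num
  have hφ1 : ∀ q, φ q ≤ 1 := fun q => by dsimp only [φ]; split_ifs <;> norm_num
  have hφ : ∀ q, |φ q| ≤ 1 := fun q => by rw [abs_of_nonneg (hφ0 q)]; exact hφ1 q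
  have hφt : Tame k φ := tame_of_bounded hφ
  refine (toMeasure_le (hF0 _) hS hφt hφ0 fun q hq _ => (if_pos hq).ge).trans
    (ENNReal.ofReal_le_ofReal ?_)
  have a1 := (abs_le.1 (abs_pair_sub_le (k := k) hclose hsT hφ)).1
  have a2 := (abs_le.1 (h.abs_mass_sub_le hclose (n := n + 1)
      ⟨le_rfl, (h.stage (n + 1)).time_nonneg⟩)).2
  have hsplit := (h.link n).split
  have hsol := (h.stage (n + 1)).sol
  have hmass := hsol.mass_eq hsT
  have hx0 := hsol.nonneg _ hsT
  have hkey : pair k φ (f (n + 1) (s n)) ≤ mass k (f (n + 1) 0) / 2 := by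
    by_cases hm : ((mesh (n + 1) : ℚ) : ℝ) ∈ S
    · rw [← hsplit]
      refine pair_mono hφt (tame_spike _) hx0 fun q hq => ?_
      by_cases hqm : q = mesh (n + 1)
      · rw [spike, if_pos hqm]; exact hφ1 q
      · have h2 : (2 : ℝ) * mesh (n + 1) ≤ q := by
          exact_mod_cast two_mesh_le_of_ne ((hsol.supp _ hsT).mem hq) hqm
        have hq' : (q : ℝ) ∉ S := fun hq' => by
          have b1 := ((hmem _).1 hm).1
          have b2 := ((hmem _).1 hq').2
          nlinarith
        exact (if_neg hq').le.trans (spike_nonneg _ _)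
    · have : pair k φ (f (n + 1) (s n)) ≤
          pair k (fun q => 1 - spike (mesh (n + 1)) q) (f (n + 1) (s n)) := by
        refine pair_mono hφt (tame_of_bounded (C := 1) fun q => ?_) hx0 fun q _ => ?_
        · rw [abs_of_nonneg (sub_nonneg.2 (spike_le_one _ _))]
          linarith [spike_nonneg (mesh (n + 1)) q]
        · by_cases hqm : q = mesh (n + 1)
          · rw [hqm]
            exact (if_neg hm).le.trans (sub_nonneg.2 (spike_le_one _ _))
          · rw [spike, if_neg hqm, sub_zero]; exact hφ1 q
      rw [pair_fun_sub tame_one (tame_spike _)] at this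
      unfold mass at hmass ⊢
      unfold atom mass at hsplit
      linarith
  linarith

lemma quarter_le_dist (h : Cascade k f T τ s) (hF0 : ∀ t q, 0 ≤ F t q)
    (hclose : ∀ n, ∀ t ∈ Icc 0 (T n), ‖f n t - F t‖ ≤ 2 * mesh n) {n : ℕ}
    (hn : 3 * (mesh (n + 1) : ℝ) < 1 / 4) {a : ℝ} (ha : 0 < a) :
    1 / 4 ≤ levyProkhorovDist (Measure.map (fun ω => a * ω) (toMeasure k (F (s n))))
      (ENNReal.ofReal (mass k (F 0)) • Measure.dirac (1 : ℝ)) := by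
  by_contra! hlt
  have hfin : IsFiniteMeasure (toMeasure k (F (s n))) :=
    ⟨by rw [toMeasure_univ (hF0 _)]; exact ENNReal.ofReal_lt_top⟩
  have hfin' : IsFiniteMeasure (ENNReal.ofReal (mass k (F 0)) • Measure.dirac (1 : ℝ)) :=
    ⟨by simp⟩
  have h1 : levyProkhorovEDist (Measure.map (fun ω => a * ω) (toMeasure k (F (s n))))
      (ENNReal.ofReal (mass k (F 0)) • Measure.dirac (1 : ℝ)) < ENNReal.ofReal (1 / 4) :=
    (ENNReal.lt_ofReal_iff_toReal_lt (levyProkhorovEDist_ne_top _ _)).2 hlt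
  have h2 := right_measure_le_of_levyProkhorovEDist_lt h1 (measurableSet_singleton 1)
  rw [ENNReal.toReal_ofReal (by norm_num), Metric.thickening_singleton,
    Measure.map_apply (measurable_const_mul a) Metric.isOpen_ball.measurableSet,
    Measure.smul_apply, Measure.dirac_apply_of_mem (mem_singleton _), smul_eq_mul, mul_one] at h2
  have h3 := h2.trans (add_le_add_left (h.toMeasure_ball_le hF0 hclose n ha) _)
  have hm := h.one_le_mass hclose
  have hmn := mesh_cast_pos (n + 1)
  rw [← ENNReal.ofReal_add (by positivity) (by norm_num),
    ENNReal.ofReal_le_ofReal_iff (by positivity)] at h3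
  linarith

theorem quarter_le_limsup (h : Cascade k f T τ s) (hF0 : ∀ t q, 0 ≤ F t q)
    (hclose : ∀ n, ∀ t ∈ Icc 0 (T n), ‖f n t - F t‖ ≤ 2 * mesh n) :
    1 / 4 ≤ limsup (fun t : ℝ => ⨅ a : Ioi (0 : ℝ),
      levyProkhorovDist (Measure.map (fun ω => (a : ℝ) * ω) (toMeasure k (F t)))
        (ENNReal.ofReal (mass k (F 0)) • Measure.dirac (1 : ℝ))) atTop := by
  have hne : Nonempty (Ioi (0 : ℝ)) := ⟨⟨1, mem_Ioi.2 one_pos⟩⟩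
  refine le_limsup_of_frequently_le (frequently_atTop.2 fun M => ?_) ⟨4, ?_⟩
  · have hev : ∀ᶠ n in atTop, 3 * (mesh (n + 1) : ℝ) < 1 / 4 :=
      ((tendsto_add_atTop_iff_nat 1).2 tendsto_mesh |>.const_mul 3).eventually_lt_const (by norm_num)
    obtain ⟨n, hn, hT⟩ := (hev.and (h.tendsto_time.eventually_ge_atTop M)).exists
    refine ⟨s n, hT.trans ((h.link n).le_tau.trans (h.link n).split_mem.1), le_ciInf fun a => ?_⟩
    exact h.quarter_le_dist hF0 hclose hn a.2
  · rw [eventually_map]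
    filter_upwards [eventually_ge_atTop 0] with t ht
    refine (ciInf_le ⟨0, ?_⟩ ⟨1, mem_Ioi.2 one_pos⟩).trans ?_
    · rintro _ ⟨a, rfl⟩
      exact ENNReal.toReal_nonneg
    · refine ENNReal.toReal_le_of_le_ofReal (by norm_num)
        ((levyProkhorovEDist_le_max_measure_univ _ _).trans (max_le ?_ ?_))
      · rw [Measure.map_apply (measurable_const_mul _) .univ, preimage_univ, toMeasure_univ (hF0 t)]
        exact ENNReal.ofReal_le_ofReal (h.mass_le_four hclose ht)
      · simpa using ENNReal.ofReal_le_ofReal (h.mass_le_four hclose le_rfl)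

end Cascade

end WeakTurbulence

/-- Existence of pulsating solutions without condensation. -/
theorem exists_pulsating_solution
    (ρ : ℝ) (hρ : ρ < -1) :
    ∃ c₁ : ℝ, 0 < c₁ ∧
      ∃ (gin : Measure ℝ) (g : ℝ → Measure ℝ) (m : ℝ),
        MemMplus ρ gin ∧ IsWeakSolution ρ 0 gin g ∧
        0 < m ∧ gin Set.univ = ENNReal.ofReal m ∧
        (∀ t : ℝ, 0 ≤ t → g t ({0} : Set ℝ) = 0) ∧
        Pulsating m g ∧
        c₁ ≤ Filter.limsup (fun t : ℝ =>
            ⨅ a : Set.Ioi (0:ℝ),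
              levyProkhorovDist (Measure.map (fun ω => (a : ℝ) * ω) (g t))
                (ENNReal.ofReal m • Measure.dirac (1:ℝ))) Filter.atTop := by
  obtain ⟨k, hk⟩ := exists_nat_ge (max (-ρ) 1)
  have hk1 : 1 ≤ k := by exact_mod_cast (le_max_right _ _).trans hk
  obtain ⟨f, T, τ, s, h⟩ := WeakTurbulence.exists_cascade hk1
  obtain ⟨F, hF, hF0, hF1, hclose⟩ := h.exists_limit
  have hsol := h.isWeakSolution hF hF0 hF1 hclose ((le_max_left _ _).trans hk)
  refine ⟨1 / 4, by norm_num, WeakTurbulence.toMeasure k (F 0),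
    fun t => WeakTurbulence.toMeasure k (F t), WeakTurbulence.mass k (F 0), hsol.1 0 le_rfl, hsol,
    zero_lt_one.trans_le (h.one_le_mass hclose), WeakTurbulence.toMeasure_univ (hF0 0),
    fun t _ => ?_, h.pulsating hF0 hclose, h.quarter_le_limsup hF0 hclose⟩
  refine WeakTurbulence.toMeasure_eq_zero (measurableSet_singleton 0) fun q hq => hF1 t q ?_
  exact_mod_cast (mem_singleton_iff.1 hq).le
end
end

section
/- Let σ ≥ 0 and φ : [0,∞) → ℝ. Define H_φ(x,y,z) := φ(z) + φ(x+y−z) − φ(x) − φ(y), Φ_σ(ω₁,ω₂;ω₃) := min{√((ω₁−σ)₊), √((ω₂−σ)₊), √((ω₃−σ)₊), √((ω₁+ω₂−ω₃−σ)₊)}, and G_{σ,φ}(ω₁,ω₂,ω₃) := (1/6) Σ_{π ∈ S₃} H_φ(ω_{π(1)}, ω_{π(2)}, ω_{π(3)}) Φ_σ(ω_{π(1)}, ω_{π(2)}; ω_{π(3)}), the sum running over all six permutations π of {1,2,3}. Then: (a) G_{σ,φ}(ω₁,ω₂,ω₃) = G_{σ,φ}(ω_{π(1)}, ω_{π(2)},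 ω_{π(3)}) for every permutation π of {1,2,3}; (b) if φ is convex on [0,∞) then G_{σ,φ} ≥ 0 on [0,∞)³; (c) if φ is concave on [0,∞) then G_{σ,φ} ≤ 0 on [0,∞)³; (d) for any φ, G_{σ,φ}(ω,ω,ω) = 0 for all ω ≥ 0. -/
open Real

noncomputable section

/-- `Φ_σ(ω₁,ω₂;ω₃) = min{√((ω₁-σ)₊), √((ω₂-σ)₊), √((ω₃-σ)₊), √((ω₁+ω₂-ω₃-σ)₊)}`. -/
def PhiSemi (σ ω₁ ω₂ ω₃ : ℝ) : ℝ := Phi4 σ ω₁ ω₂ ω₃ (ω₁ + ω₂ - ω₃)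

/-- `H_φ(x,y,z) = φ(z) + φ(x+y-z) - φ(x) - φ(y)`. -/
def Hfun (φ : ℝ → ℝ) (x y z : ℝ) : ℝ := φ z + φ (x + y - z) - φ x - φ y

/-- The symmetrized kernel `G_{σ,φ}`. -/
def Gsig (σ : ℝ) (φ : ℝ → ℝ) (ω₁ ω₂ ω₃ : ℝ) : ℝ :=
  (1/6) * ∑ pr : Equiv.Perm (Fin 3),
    Hfun φ (![ω₁, ω₂, ω₃] (pr 0)) (![ω₁, ω₂, ω₃] (pr 1)) (![ω₁, ω₂, ω₃] (pr 2)) *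
      PhiSemi σ (![ω₁, ω₂, ω₃] (pr 0)) (![ω₁, ω₂, ω₃] (pr 1)) (![ω₁, ω₂, ω₃] (pr 2))

/-- Majorization for two points: a convex function has the larger sum at the more spread-out of
two pairs of points with equal sums. -/
theorem ConvexOn.add_le_add_of_add_eq {s : Set ℝ} {f : ℝ → ℝ} (hf : ConvexOn ℝ s f)
    {a b c d : ℝ} (ha : a ∈ s) (hb : b ∈ s) (hac : a ≤ c) (had : a ≤ d) (h : a + b = c + d) :
    f c + f d ≤ f a + f b := by
  rcases (show a ≤ b by linarith).eq_or_lt with hab | hab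
  · obtain rfl : c = a := by linarith
    obtain rfl : d = b := by linarith
    exact le_rfl
  have hba : 0 < b - a := sub_pos.2 hab
  have hsum : (d - a) / (b - a) + (c - a) / (b - a) = 1 := by
    rw [← add_div, div_eq_one_iff_eq hba.ne']
    linarith
  have hd0 : 0 ≤ (d - a) / (b - a) := div_nonneg (by linarith) hba.le
  have hc0 : 0 ≤ (c - a) / (b - a) := div_nonneg (by linarith) hba.le
  have hc := hf.2 ha hb hd0 hc0 hsum
  have hd := hf.2 ha hb hc0 hd0 (by rw [add_comm, hsum])
  have ec : (d - a) / (b - a) * a + (c - a) / (b - a) * b = c := by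
    obtain rfl : d = a + b - c := by linarith
    field_simp
    ring
  have ed : (c - a) / (b - a) * a + (d - a) / (b - a) * b = d := by
    obtain rfl : d = a + b - c := by linarith
    field_simp
    ring
  simp only [smul_eq_mul, ec, ed] at hc hd
  linear_combination hc + hd + (f a + f b) * hsum

theorem Hfun_neg (φ : ℝ → ℝ) (x y z : ℝ) : Hfun (-φ) x y z = -Hfun φ x y z := by
  simp only [Hfun, Pi.neg_apply]
  ring

theorem Hfun_comm (φ : ℝ → ℝ) (x y z : ℝ) : Hfun φ x y z = Hfun φ y x z := by
  simp only [Hfun, add_comm x y]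
  ring

theorem PhiSemi_comm (σ x y z : ℝ) : PhiSemi σ x y z = PhiSemi σ y x z := by
  simp only [PhiSemi, Phi4, add_comm x y, min_comm (Real.sqrt (max (x - σ) 0))]

theorem PhiSemi_nonneg (σ x y z : ℝ) : 0 ≤ PhiSemi σ x y z := by
  simp [PhiSemi, Phi4]

theorem PhiSemi_eq_zero {σ x y z : ℝ} (h : x + y - z ≤ σ) : PhiSemi σ x y z = 0 := by
  simp [PhiSemi, Phi4, max_eq_right (sub_nonpos.2 h)]

/-- If the first frequency is the smallest of the four, it determines `PhiSemi`. -/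
theorem PhiSemi_eq_sqrt {σ x y z : ℝ} (hxy : x ≤ y) (hxz : x ≤ z) (hzy : z ≤ y) :
    PhiSemi σ x y z = Real.sqrt (max (x - σ) 0) := by
  have key : ∀ t, x ≤ t → Real.sqrt (max (x - σ) 0) ≤ Real.sqrt (max (t - σ) 0) := fun t ht =>
    Real.sqrt_le_sqrt (max_le_max_right 0 (sub_le_sub_right ht σ))
  rw [PhiSemi, Phi4, min_eq_left (key y hxy),
    min_eq_left (le_min (key z hxz) (key _ (by linarith)))]

/-- If the third frequency is the smallest of the four, it determines `PhiSemi`. -/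
theorem PhiSemi_eq_sqrt_third {σ x y z : ℝ} (hzx : z ≤ x) (hzy : z ≤ y) :
    PhiSemi σ x y z = Real.sqrt (max (z - σ) 0) := by
  have key : ∀ t, z ≤ t → Real.sqrt (max (z - σ) 0) ≤ Real.sqrt (max (t - σ) 0) := fun t ht =>
    Real.sqrt_le_sqrt (max_le_max_right 0 (sub_le_sub_right ht σ))
  rw [PhiSemi, Phi4, min_eq_left (key (x + y - z) (by linarith)),
    min_eq_right (le_min (key x hzx) (key y hzy))]

theorem Gsig_eq (σ : ℝ) (φ : ℝ → ℝ) (x y z : ℝ) :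
    Gsig σ φ x y z = (1 / 3) * (Hfun φ x y z * PhiSemi σ x y z + Hfun φ x z y * PhiSemi σ x z y +
      Hfun φ y z x * PhiSemi σ y z x) := by
  have huniv : (Finset.univ : Finset (Equiv.Perm (Fin 3))) =
      {1, Equiv.swap 0 1, Equiv.swap 0 2, Equiv.swap 1 2, Equiv.swap 0 1 * Equiv.swap 1 2,
        Equiv.swap 1 2 * Equiv.swap 0 1} := by decide
  rw [Gsig, huniv]
  repeat rw [Finset.sum_insert (by decide)]
  rw [Finset.sum_singleton]
  simp [Equiv.swap_apply_def]
  rw [Hfun_comm φ y x z, PhiSemi_comm σ y x z, Hfun_comm φ z x y, PhiSemi_comm σ z x y,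
    Hfun_comm φ z y x, PhiSemi_comm σ z y x]
  ring

theorem Gsig_neg (σ : ℝ) (φ : ℝ → ℝ) (x y z : ℝ) : Gsig σ (-φ) x y z = -Gsig σ φ x y z := by
  simp only [Gsig_eq, Hfun_neg]
  ring

theorem Gsig_self (σ : ℝ) (φ : ℝ → ℝ) (x : ℝ) : Gsig σ φ x x x = 0 := by
  simp [Gsig_eq, Hfun]

theorem Gsig_perm (σ : ℝ) (φ : ℝ → ℝ) (v : Fin 3 → ℝ) (p : Equiv.Perm (Fin 3)) :
    Gsig σ φ (v (p 0)) (v (p 1)) (v (p 2)) = Gsig σ φ (v 0) (v 1) (v 2) := by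
  have hv : ∀ w : Fin 3 → ℝ, ![w 0, w 1, w 2] = w := fun w => by
    ext i
    fin_cases i <;> rfl
  have hp : ![v (p 0), v (p 1), v (p 2)] = v ∘ p := hv (v ∘ p)
  rw [Gsig, Gsig, hp, hv v]
  exact congrArg _ (Equiv.sum_comp (Equiv.mulLeft p) fun q =>
    Hfun φ (v (q 0)) (v (q 1)) (v (q 2)) * PhiSemi σ (v (q 0)) (v (q 1)) (v (q 2)))

theorem Gsig_nonneg_of_le {σ : ℝ} (hσ : 0 ≤ σ) {φ : ℝ → ℝ} (hφ : ConvexOn ℝ (Set.Ici 0) φ)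
    {x y z : ℝ} (hx : 0 ≤ x) (hxy : x ≤ y) (hyz : y ≤ z) : 0 ≤ Gsig σ φ x y z := by
  have hfst : 0 ≤ Hfun φ x y z * PhiSemi σ x y z := by
    rcases le_total (x + y - z) 0 with h | h
    · rw [PhiSemi_eq_zero (h.trans hσ), mul_zero]
    · refine mul_nonneg ?_ (PhiSemi_nonneg ..)
      have := hφ.add_le_add_of_add_eq (a := x + y - z) (b := z) (c := x) (d := y)
        h (Set.mem_Ici.2 (by linarith)) (by linarith) (by linarith) (by ring)
      simp only [Hfun]
      linarith
  have hH : 0 ≤ Hfun φ x z y + Hfun φ y z x := by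
    have := hφ.add_le_add_of_add_eq (a := x + z - y) (b := y + z - x) (c := z) (d := z)
      (Set.mem_Ici.2 (by linarith)) (Set.mem_Ici.2 (by linarith)) (by linarith) (by linarith)
      (by ring)
    simp only [Hfun]
    linarith
  rw [Gsig_eq, PhiSemi_eq_sqrt (hxy.trans hyz) hxy hyz,
    PhiSemi_eq_sqrt_third hxy (hxy.trans hyz), add_assoc, ← add_mul]
  have := mul_nonneg hH (Real.sqrt_nonneg (max (x - σ) 0))
  positivity

theorem Gsig_nonneg {σ : ℝ} (hσ : 0 ≤ σ) {φ : ℝ → ℝ} (hφ : ConvexOn ℝ (Set.Ici 0) φ)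
    {x y z : ℝ} (hx : 0 ≤ x) (hy : 0 ≤ y) (hz : 0 ≤ z) : 0 ≤ Gsig σ φ x y z := by
  have hv : ∀ i, 0 ≤ ![x, y, z] i := by
    intro i
    fin_cases i <;> simpa
  have hmono := Tuple.monotone_sort ![x, y, z]
  have h := Gsig_perm σ φ ![x, y, z] (Tuple.sort ![x, y, z])
  exact (Gsig_nonneg_of_le hσ hφ (hv _) (hmono (by decide : (0 : Fin 3) ≤ 1))
    (hmono (by decide : (1 : Fin 3) ≤ 2))).trans_eq h

/-- Symmetry, sign and diagonal-vanishing properties of `G_{σ,φ}` (Proposition 2.15). -/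
theorem Gsig_properties (σ : ℝ) (hσ : 0 ≤ σ) (φ : ℝ → ℝ) :
    (∀ ω₁ ω₂ ω₃ : ℝ, ∀ pr : Equiv.Perm (Fin 3),
        Gsig σ φ ω₁ ω₂ ω₃ =
          Gsig σ φ (![ω₁, ω₂, ω₃] (pr 0)) (![ω₁, ω₂, ω₃] (pr 1)) (![ω₁, ω₂, ω₃] (pr 2))) ∧
    (ConvexOn ℝ (Set.Ici 0) φ →
      ∀ ω₁ ω₂ ω₃ : ℝ, 0 ≤ ω₁ → 0 ≤ ω₂ → 0 ≤ ω₃ → 0 ≤ Gsig σ φ ω₁ ω₂ ω₃) ∧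
    (ConcaveOn ℝ (Set.Ici 0) φ →
      ∀ ω₁ ω₂ ω₃ : ℝ, 0 ≤ ω₁ → 0 ≤ ω₂ → 0 ≤ ω₃ → Gsig σ φ ω₁ ω₂ ω₃ ≤ 0) ∧
    (∀ ω : ℝ, 0 ≤ ω → Gsig σ φ ω ω ω = 0) := by
  refine ⟨fun x y z p => (Gsig_perm σ φ ![x, y, z] p).symm,
    fun hφ x y z hx hy hz => Gsig_nonneg hσ hφ hx hy hz, fun hφ x y z hx hy hz => ?_,
    fun x _ => Gsig_self σ φ x⟩
  have := Gsig_nonneg hσ hφ.neg hx hy hz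
  rw [Gsig_neg] at this
  linarith
end
end

section
/- Let A be a nonempty closed subset of [0,∞), let A* be its extended set, and let R* := inf(A*). If R* > 0, then there exists a finite set of positive real numbers {D_k}_{k=1}^L such that A* = { R* + Σ_{k=1}^L n_k D_k : n_k ∈ ℕ = {0,1,2,...} }. Moreover, for all j,k ∈ {1,...,L} the quotient D_j/D_k is a rational number, and min_{1≤k≤L} D_k ≥ R*. -/
open Set Pointwise

noncomputable section

/-- The iterates `A₁ = A`, `A_{n+1} = (A_n + A_n - A_n) ∩ (0,∞)` (pointwise set operations). -/
def iterSet (A : Set ℝ) : ℕ → Set ℝ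
  | 0 => A
  | n + 1 => (iterSet A n + iterSet A n - iterSet A n) ∩ Set.Ioi 0

/-- The extended set `A*`. -/
def extSet (A : Set ℝ) : Set ℝ := ⋃ n : ℕ, iterSet A (n + 1)

theorem iterSet_succ_mono (A : Set ℝ) : Monotone fun n => iterSet A (n + 1) :=
  monotone_nat_of_le_succ fun _ x hx =>
    ⟨⟨x + x, ⟨x, hx, x, hx, rfl⟩, x, hx, by ring⟩, hx.2⟩

theorem pos_of_mem_extSet {A : Set ℝ} {x : ℝ} (hx : x ∈ extSet A) : 0 < x := by
  obtain ⟨n, hn⟩ := mem_iUnion.1 hx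
  exact hn.2

theorem add_sub_mem_extSet {A : Set ℝ} {x y z : ℝ} (hx : x ∈ extSet A) (hy : y ∈ extSet A)
    (hz : z ∈ extSet A) (hpos : 0 < x + y - z) : x + y - z ∈ extSet A := by
  obtain ⟨i, hi⟩ := mem_iUnion.1 hx
  obtain ⟨j, hj⟩ := mem_iUnion.1 hy
  obtain ⟨k, hk⟩ := mem_iUnion.1 hz
  let m := max i (max j k)
  have hi' := iterSet_succ_mono A (show i ≤ m by omega) hi
  have hj' := iterSet_succ_mono A (show j ≤ m by omega) hj
  have hk' := iterSet_succ_mono A (show k ≤ m by omega) hk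
  exact mem_iUnion.2 ⟨m + 1, ⟨x + y, ⟨x, hi', y, hj', rfl⟩, z, hk', rfl⟩, hpos⟩

theorem bddBelow_extSet (A : Set ℝ) : BddBelow (extSet A) :=
  ⟨0, fun _ hx => (pos_of_mem_extSet hx).le⟩

/-- Distinct points of the extended set are at least `inf A*` apart. -/
theorem sInf_extSet_le_sub {A : Set ℝ} {x y : ℝ} (hx : x ∈ extSet A) (hy : y ∈ extSet A)
    (hxy : x < y) : sInf (extSet A) ≤ y - x := by
  by_contra! h
  obtain ⟨z, hz, hlt⟩ := exists_lt_of_csInf_lt ⟨x, hx⟩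
    (show sInf (extSet A) < sInf (extSet A) + (y - x) by linarith)
  have hle := csInf_le (bddBelow_extSet A) hz
  have := csInf_le (bddBelow_extSet A) (add_sub_mem_extSet hz hx hy (by linarith))
  linarith

theorem exists_isLeast_of_subset_extSet {A T : Set ℝ} (hR : 0 < sInf (extSet A))
    (hT : T ⊆ extSet A) (hne : T.Nonempty) : ∃ t, IsLeast T t := by
  have hbdd : BddBelow T := (bddBelow_extSet A).mono hT
  obtain ⟨t, ht, hlt⟩ := exists_lt_of_csInf_lt hne
    (show sInf T < sInf T + sInf (extSet A) by linarith)
  refine ⟨t, ht, fun y hy => ?_⟩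
  by_contra! h
  have := sInf_extSet_le_sub (hT hy) (hT ht) h
  have := csInf_le hbdd hy
  linarith

theorem add_nat_mul_sub_mem_extSet {A : Set ℝ} {x y z : ℝ} (hx : x ∈ extSet A)
    (hy : y ∈ extSet A) (hz : z ∈ extSet A) (n : ℕ) (hpos : 0 < x + n * (y - z)) :
    x + n * (y - z) ∈ extSet A := by
  induction n with
  | zero => simpa using hx
  | succ n ih =>
    have hx0 := pos_of_mem_extSet hx
    push_cast at hpos ⊢
    have hn : (0 : ℝ) ≤ n := n.cast_nonneg
    have hprev : 0 < x + n * (y - z) := by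
      rcases le_total z y with h | h
      · nlinarith [mul_nonneg hn (sub_nonneg.2 h)]
      · linarith
    convert add_sub_mem_extSet (ih hprev) hy hz (by linarith) using 1
    ring

/-- If `inf A* > 0`, the extended set is a single point or an arithmetic progression. -/
theorem extSet_eq_singleton_or_progression {A : Set ℝ} (hne : (extSet A).Nonempty)
    (hR : 0 < sInf (extSet A)) :
    extSet A = {sInf (extSet A)} ∨ ∃ d, sInf (extSet A) ≤ d ∧
      extSet A = {x : ℝ | ∃ n : ℕ, x = sInf (extSet A) + n * d} := by
  have hmem : sInf (extSet A) ∈ extSet A := by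
    obtain ⟨r, hr⟩ := exists_isLeast_of_subset_extSet hR Subset.rfl hne
    exact hr.csInf_eq.symm ▸ hr.1
  have hle {x : ℝ} (hx : x ∈ extSet A) : sInf (extSet A) ≤ x := csInf_le (bddBelow_extSet A) hx
  set R := sInf (extSet A)
  rcases (extSet A ∩ Ioi R).eq_empty_or_nonempty with hT | hT
  · refine Or.inl (Subset.antisymm (fun x hx => ?_) (singleton_subset_iff.2 hmem))
    by_contra hxR
    exact (hT ▸ ⟨hx, lt_of_le_of_ne (hle hx) (Ne.symm hxR)⟩ : x ∈ (∅ : Set ℝ))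
  obtain ⟨s, ⟨hs, hRs⟩, hleast⟩ := exists_isLeast_of_subset_extSet hR inter_subset_left hT
  have hgap : R ≤ s - R := sInf_extSet_le_sub hmem hs hRs
  have hd : 0 < s - R := hR.trans_le hgap
  refine Or.inr ⟨s - R, hgap, Subset.antisymm (fun x hx => ?_) ?_⟩
  · have hxR : 0 ≤ x - R := sub_nonneg.2 (hle hx)
    refine ⟨⌊(x - R) / (s - R)⌋₊, ?_⟩
    have hlow := (le_div_iff₀ hd).1 (Nat.floor_le (div_nonneg hxR hd.le))
    have hhigh := (div_lt_iff₀ hd).1 (Nat.lt_floor_add_one ((x - R) / (s - R)))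
    have hy := add_nat_mul_sub_mem_extSet hx hmem hs ⌊(x - R) / (s - R)⌋₊ (by linarith)
    by_contra hne'
    have hlt : R < x + ⌊(x - R) / (s - R)⌋₊ * (R - s) :=
      lt_of_le_of_ne (hle hy) fun h => hne' (by linarith)
    have := hleast ⟨hy, hlt⟩
    linarith
  · rintro x ⟨n, rfl⟩
    exact add_nat_mul_sub_mem_extSet hmem hs hmem n (by positivity)

/-- Structure of the extended set when `R* = inf A* > 0` (Lemma 3.6). -/
theorem extended_set_structure
    (A : Set ℝ) (hne : A.Nonempty) (hcl : IsClosed A) (hsub : A ⊆ Set.Ici 0)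
    (hne' : (extSet A).Nonempty)
    (hR : 0 < sInf (extSet A)) :
    ∃ (L : ℕ) (D : Fin L → ℝ),
      (∀ k, 0 < D k) ∧
      extSet A = {x : ℝ | ∃ n : Fin L → ℕ, x = sInf (extSet A) + ∑ k, (n k : ℝ) * D k} ∧
      (∀ j k, ∃ q : ℚ, D j / D k = (q : ℝ)) ∧
      (∀ k, sInf (extSet A) ≤ D k) := by
  rcases extSet_eq_singleton_or_progression hne' hR with h | ⟨d, hd, h⟩
  · refine ⟨0, Fin.elim0, fun k => k.elim0, ?_, fun k => k.elim0, fun k => k.elim0⟩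
    refine h.trans ?_
    ext x
    simp
  · have hd0 : 0 < d := hR.trans_le hd
    refine ⟨1, fun _ => d, fun _ => hd0, ?_, fun _ _ => ⟨1, by simp [hd0.ne']⟩, fun _ => hd⟩
    refine h.trans ?_
    ext x
    simp only [mem_ofPred_eq, Fin.sum_univ_one]
    exact ⟨fun ⟨n, hn⟩ => ⟨fun _ => n, hn⟩, fun ⟨n, hn⟩ => ⟨n 0, hn⟩⟩
end
end
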